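/- arXiv:1606.06903 — 4 statements merged into one kernel-verified Lean document; each statement's English description precedes it below -/
import Mathlib

section
/- Let 𝐗, 𝐘, Z be pairwise disjoint node sets in a DAG D with 𝐗 and 𝐘 nonempty. If Z does not satisfy the adjustment criterion relative to (𝐗,𝐘) in D, then there exist a linear Gaussian structural equation model compatible with D and a node Y ∈ 𝐘 such that E[Y | do(𝐗 = 1)] ≠ E[Y | 𝐗 = 1] when Z = ∅, and E[Y | do(𝐗 = 1)] ≠ ∫ E[Y | 𝐗 = 1, Z = z] f_Z(z) dz when Z ≠ ∅, where f_Z is the observational marginal density of Z. -/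
attribute [local instance] Classical.propDecidable

/-- A finite directed acyclic graph on vertex type `V`. -/
structure DAG (V : Type) [Fintype V] [DecidableEq V] where
  /-- the edge relation: `Edge a b` means there is a directed edge `a → b` -/
  Edge : V → V → Prop
  /-- there are no directed cycles -/
  acyclic : ∀ v, ¬ Relation.TransGen Edge v v

namespace DAG

variable {V : Type} [Fintype V] [DecidableEq V]

/-- two nodes are adjacent if they are joined by an edge in either direction -/
def Adj (D : DAG V) (a b : V) : Prop := D.Edge a b ∨ D.Edge b a

/-- `p` is a path from `x` to `y`: a list of distinct nodes, consecutive ones adjacent,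
starting at `x` and ending at `y`. -/
def IsPathFrom (D : DAG V) (p : List V) (x y : V) : Prop :=
  p.Nodup ∧ p.Chain' D.Adj ∧ p.head? = some x ∧ p.getLast? = some y

/-- a causal (directed) path: all edges point forward -/
def IsCausal (D : DAG V) (p : List V) : Prop := p.Chain' D.Edge

/-- descendants of a set of nodes (every node is its own descendant) -/
def Desc (D : DAG V) (S : Set V) : Set V :=
  {v | ∃ w ∈ S, Relation.ReflTransGen D.Edge w v}

/-- ancestors of a set of nodes (every node is its own ancestor) -/
def Anc (D : DAG V) (S : Set V) : Set V :=
  {v | ∃ w ∈ S, Relation.ReflTransGen D.Edge v w}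

/-- `w` is a collider on the path `p`: both edges of `p` at `w` point into `w` -/
def IsColliderOn (D : DAG V) (p : List V) (w : V) : Prop :=
  ∃ a b, [a, w, b] <:+: p ∧ D.Edge a w ∧ D.Edge b w

/-- `w` is a non-collider on `p`: a non-endpoint node of `p` that is not a collider on `p` -/
def IsNonColliderOn (D : DAG V) (p : List V) (w : V) : Prop :=
  (∃ a b, [a, w, b] <:+: p) ∧ ¬ D.IsColliderOn p w

/-- `Z` blocks the path `p`: some non-collider on `p` is in `Z`, or some collider on `p`
has no descendant in `Z`.  Otherwise `p` is d-connecting given `Z`. -/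
def Blocks (D : DAG V) (Z : Set V) (p : List V) : Prop :=
  (∃ w, D.IsNonColliderOn p w ∧ w ∈ Z) ∨
  (∃ w, D.IsColliderOn p w ∧ D.Desc {w} ∩ Z = ∅)

/-- `p` is a proper causal path from `X` to `Y` -/
def ProperCausalPath (D : DAG V) (X Y : Set V) (p : List V) : Prop :=
  (∃ x ∈ X, ∃ y ∈ Y, D.IsPathFrom p x y) ∧ (∀ v ∈ p.tail, v ∉ X) ∧ D.IsCausal p

/-- `p` is a proper non-causal path from `X` to `Y` -/
def ProperNonCausalPath (D : DAG V) (X Y : Set V) (p : List V) : Prop :=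
  (∃ x ∈ X, ∃ y ∈ Y, D.IsPathFrom p x y) ∧ (∀ v ∈ p.tail, v ∉ X) ∧ ¬ D.IsCausal p

/-- the forbidden set: all descendants of nodes `W ∉ X` lying on a proper causal path
from `X` to `Y` -/
def Forb (D : DAG V) (X Y : Set V) : Set V :=
  {v | ∃ p w, D.ProperCausalPath X Y p ∧ w ∈ p ∧ w ∉ X ∧
    Relation.ReflTransGen D.Edge w v}

/-- the adjustment criterion of Shpitser et al. / van der Zander et al. -/
def SatisfiesAC (D : DAG V) (X Y Z : Set V) : Prop :=
  Z ∩ D.Forb X Y = ∅ ∧ ∀ p, D.ProperNonCausalPath X Y p → D.Blocks Z p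

/-- the constructive set `Adjust(X,Y,D)` -/
def AdjustSet (D : DAG V) (X Y : Set V) : Set V :=
  D.Anc (X ∪ Y) \ (X ∪ Y ∪ D.Forb X Y)

/-- `Z` d-separates `X` and `Y` in `D`: `Z` blocks every path from `X` to `Y` -/
def DSep (D : DAG V) (X Y Z : Set V) : Prop :=
  ∀ x ∈ X, ∀ y ∈ Y, ∀ p, D.IsPathFrom p x y → D.Blocks Z p

/-- `p` is a back-door path from `x`: its first edge points into `x` -/
def IsBackdoorFrom (D : DAG V) (p : List V) (x : V) : Prop :=
  ∃ b rest, p = x :: b :: rest ∧ D.Edge b x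

/-- Pearl's back-door criterion -/
def BackdoorCriterion (D : DAG V) (X Y Z : Set V) : Prop :=
  Z ∩ D.Desc X = ∅ ∧
  ∀ x ∈ X, ∀ y ∈ Y, ∀ p, D.IsPathFrom p x y → D.IsBackdoorFrom p x → D.Blocks Z p

/-- the generalized back-door criterion of Maathuis and Colombo -/
def GenBackdoorCriterion (D : DAG V) (X Y Z : Set V) : Prop :=
  Z ∩ D.Desc X = ∅ ∧
  ∀ x ∈ X, ∀ y ∈ Y, ∀ p, D.IsPathFrom p x y → D.IsBackdoorFrom p x →
    D.Blocks ((Z ∪ X) \ {x}) p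

end DAG

open MeasureTheory

/-- a linear Gaussian structural equation model compatible with the DAG `D`:
`V = coef · V + ε`, where `coef j i ≠ 0` only if `i → j` is an edge of `D` and the
errors are independent mean-zero Gaussians with strictly positive variances. -/
structure GaussianSEM (V : Type) [Fintype V] [DecidableEq V] (D : DAG V) where
  /-- the matrix of edge coefficients -/
  coef : Matrix V V ℝ
  /-- the error variances -/
  errVar : V → NNReal
  /-- nonzero coefficients only along edges of `D` -/
  compat : ∀ i j, coef j i ≠ 0 → D.Edge i j
  /-- error variances are strictly positive -/
  errVar_pos : ∀ i, 0 < errVar i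

namespace GaussianSEM

variable {V : Type} [Fintype V] [DecidableEq V] {D : DAG V}

/-- the covariance matrix of the induced (non-degenerate, mean-zero) multivariate
Gaussian observational distribution -/
noncomputable def cov (S : GaussianSEM V D) : Matrix V V ℝ :=
  (1 - S.coef)⁻¹ * Matrix.diagonal (fun i => (S.errVar i : ℝ)) *
    Matrix.transpose (1 - S.coef)⁻¹

/-- `E[Y | do(X = x)]`: the mean of node `y` in the intervened model, in which the
structural equations of the nodes in `X` are replaced by the constant assignment `x` -/
noncomputable def doMean (S : GaussianSEM V D) (X : Set V) (x : V → ℝ) (y : V) : ℝ :=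
  Matrix.mulVec (1 - Matrix.of fun i j => if i ∈ X then 0 else S.coef i j)⁻¹
    (fun i => if i ∈ X then x i else 0) y

/-- `E[Y | W = w]`: the conditional expectation of node `y` given the values `w` on the
node set `W`, in the observational (mean-zero Gaussian) distribution; by the standard
formula for Gaussian conditioning this is `Σ_{yW} (Σ_{WW})⁻¹ w`. -/
noncomputable def condExp (S : GaussianSEM V D) (y : V) (W : Set V) (w : V → ℝ) : ℝ :=
  ∑ i : W,
    S.cov y i.1 *
      Matrix.mulVec ((S.cov.submatrix (fun a : W => a.1) fun a : W => a.1)⁻¹)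
        (fun j : W => w j.1) i

/-- the distribution of the error vector `ε` -/
noncomputable def noise (S : GaussianSEM V D) : Measure (V → ℝ) :=
  Measure.pi fun i => ProbabilityTheory.gaussianReal 0 (S.errVar i)

/-- the observational distribution of `V = (1 - coef)⁻¹ ε` -/
noncomputable def obs (S : GaussianSEM V D) : Measure (V → ℝ) :=
  S.noise.map fun e => Matrix.mulVec (1 - S.coef)⁻¹ e

/-- the observational marginal distribution of the node set `Z` -/
noncomputable def margZ (S : GaussianSEM V D) (Z : Set V) :
    Measure ((i : Z) → ℝ) :=
  S.obs.map fun v (i : Z) => v i.1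

/-- `∫ E[Y | X = x, Z = z] f_Z(z) dz`: the integral of the conditional expectation of
`y` given `X = x, Z = z` against the observational marginal distribution of `Z` -/
noncomputable def adjIntegral (S : GaussianSEM V D) (X Z : Set V) (x : V → ℝ)
    (y : V) : ℝ :=
  ∫ z : (i : Z) → ℝ,
    S.condExp y (X ∪ Z) (fun i => if h : i ∈ Z then z ⟨i, h⟩ else x i) ∂ S.margZ Z

end GaussianSEM

namespace DAG

variable {V : Type} [Fintype V] [DecidableEq V]

lemma wellFounded_transGen (D : DAG V) : WellFounded (Relation.TransGen D.Edge) :=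
  have : Std.Irrefl (Relation.TransGen D.Edge) := ⟨D.acyclic⟩
  Finite.wellFounded_of_trans_of_irrefl _

lemma isUnit_one_sub_of_compat (D : DAG V) (A : Matrix V V ℝ)
    (hA : ∀ i j, A j i ≠ 0 → D.Edge i j) : IsUnit (1 - A) := by
  rw [← Matrix.mulVec_injective_iff_isUnit,
    ← Matrix.coe_mulVecLin, ← LinearMap.ker_eq_bot, LinearMap.ker_eq_bot']
  intro f hf
  have hrow : ∀ i, f i = ∑ j, A i j * f j := by
    intro i
    have := congrFun hf i
    rw [Matrix.mulVecLin_apply, Matrix.sub_mulVec, Matrix.one_mulVec] at this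
    exact sub_eq_zero.1 this
  funext i
  induction i using D.wellFounded_transGen.induction with
  | _ i ih =>
    rw [hrow i]
    refine Finset.sum_eq_zero fun j _ => ?_
    by_cases h : A i j = 0
    · simp [h]
    · simp [ih j (.single (hA j i h))]

end DAG

namespace GaussianSEM

open Matrix

variable {V : Type} [Fintype V] [DecidableEq V] {D : DAG V}

lemma isUnit_det_one_sub_coef (S : GaussianSEM V D) : IsUnit (1 - S.coef).det :=
  (Matrix.isUnit_iff_isUnit_det _).1 (D.isUnit_one_sub_of_compat _ S.compat)

lemma posDef_cov (S : GaussianSEM V D) : S.cov.PosDef := by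
  have hd : (Matrix.diagonal fun i => (S.errVar i : ℝ)).PosDef :=
    Matrix.PosDef.diagonal fun i => NNReal.coe_pos.2 (S.errVar_pos i)
  have hu : IsUnit (1 - S.coef)⁻¹ :=
    (Matrix.isUnit_nonsing_inv_iff).2 (D.isUnit_one_sub_of_compat _ S.compat)
  have := hd.mul_mul_conjTranspose_same (B := (1 - S.coef)⁻¹)
    (Matrix.vecMul_injective_iff_isUnit.2 hu)
  simpa [cov, Matrix.conjTranspose_eq_transpose_of_trivial] using this

/-- The conditional mean is determined by any vector `Σ μ` with `μ` supported on the
conditioning set that takes the prescribed values there. -/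
lemma condExp_eq_of_mulVec (S : GaussianSEM V D) (W : Set V) (w μ : V → ℝ)
    (hμ : ∀ v ∉ W, μ v = 0) (hw : ∀ v ∈ W, (S.cov *ᵥ μ) v = w v) (y : V) :
    S.condExp y W w = (S.cov *ᵥ μ) y := by
  have hsum : ∀ v, (S.cov *ᵥ μ) v = ∑ i : W, S.cov v i.1 * μ i.1 := by
    intro v
    refine Eq.trans ?_ (Finset.sum_subtype (p := (· ∈ W)) (Finset.univ.filter (· ∈ W))
      (by simp) fun i => S.cov v i * μ i)
    exact (Finset.sum_subset (Finset.subset_univ _)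
      fun i _ hi => by rw [hμ i (by simpa using hi), mul_zero]).symm
  have hpd : (S.cov.submatrix (fun a : W => a.1) fun a : W => a.1).PosDef :=
    S.posDef_cov.submatrix Subtype.val_injective
  have hres : (fun j : W => w j.1) =
      (S.cov.submatrix (fun a : W => a.1) fun a : W => a.1) *ᵥ fun j : W => μ j.1 := by
    funext j
    rw [← hw j.1 j.2, hsum]
    rfl
  unfold condExp
  rw [hres, Matrix.mulVec_mulVec, Matrix.nonsing_inv_mul _
    ((Matrix.isUnit_iff_isUnit_det _).1 hpd.isUnit), Matrix.one_mulVec, hsum]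

lemma condExp_eq_of_residual (S : GaussianSEM V D) (W : Set V) (w m l : V → ℝ)
    (hrow : ∀ v, m v = ∑ u, S.coef v u * m u + S.errVar v * l v)
    (hbal : ∀ v ∉ W, l v = ∑ c, S.coef c v * l c) (hw : ∀ v ∈ W, m v = w v) (y : V) :
    S.condExp y W w = m y := by
  have hu := S.isUnit_det_one_sub_coef
  have hm : S.cov *ᵥ ((1 - S.coef)ᵀ *ᵥ l) = m := by
    have h1 : (1 - S.coef) *ᵥ m = (Matrix.diagonal fun i => (S.errVar i : ℝ)) *ᵥ l := by
      funext v
      rw [Matrix.sub_mulVec, Matrix.one_mulVec, Matrix.mulVec_diagonal, Pi.sub_apply]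
      simp only [Matrix.mulVec, dotProduct]
      linarith [hrow v]
    have h2 : ((1 - S.coef)⁻¹)ᵀ * (1 - S.coef)ᵀ = 1 := by
      rw [← Matrix.transpose_mul, Matrix.mul_nonsing_inv _ hu, Matrix.transpose_one]
    unfold cov
    rw [Matrix.mulVec_mulVec, Matrix.mul_assoc, h2, Matrix.mul_one, ← Matrix.mulVec_mulVec,
      ← h1, Matrix.mulVec_mulVec, Matrix.nonsing_inv_mul _ hu, Matrix.one_mulVec]
  have := S.condExp_eq_of_mulVec W w ((1 - S.coef)ᵀ *ᵥ l) ?_ (by rwa [hm]) y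
  · rw [this, hm]
  · intro v hv
    rw [Matrix.transpose_sub, Matrix.transpose_one, Matrix.sub_mulVec, Matrix.one_mulVec,
      Pi.sub_apply, hbal v hv]
    simp [Matrix.mulVec, dotProduct]

lemma doMean_eq_of_rows (S : GaussianSEM V D) (X : Set V) (x n : V → ℝ)
    (hX : ∀ v ∈ X, n v = x v) (hrow : ∀ v ∉ X, n v = ∑ u, S.coef v u * n u) (y : V) :
    S.doMean X x y = n y := by
  set A : Matrix V V ℝ := Matrix.of fun i j => if i ∈ X then 0 else S.coef i j with hA
  have hu : IsUnit (1 - A).det := (Matrix.isUnit_iff_isUnit_det _).1 <|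
    D.isUnit_one_sub_of_compat A fun i j h => S.compat i j fun h0 => h (by simp [hA, h0])
  have hn : (fun i => if i ∈ X then x i else 0) = (1 - A) *ᵥ n := by
    funext v
    rw [Matrix.sub_mulVec, Matrix.one_mulVec, Pi.sub_apply]
    by_cases hv : v ∈ X
    · simp [hA, hv, Matrix.mulVec, dotProduct, hX v hv]
    · simp [hA, hv, Matrix.mulVec, dotProduct, ← hrow v hv]
  unfold doMean
  rw [hn, Matrix.mulVec_mulVec, Matrix.nonsing_inv_mul _ hu, Matrix.one_mulVec]

instance (S : GaussianSEM V D) : IsProbabilityMeasure S.noise := by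
  unfold noise; infer_instance

lemma integrable_noise_eval (S : GaussianSEM V D) (i : V) :
    Integrable (fun e : V → ℝ => e i) S.noise :=
  integrable_comp_eval (f := id) <| memLp_one_iff_integrable.1 <| by
    simpa using ProbabilityTheory.memLp_id_gaussianReal (μ := 0) (v := S.errVar i) 1

lemma integral_noise_eval (S : GaussianSEM V D) (i : V) : ∫ e, e i ∂S.noise = 0 :=
  (integral_comp_eval (μ := fun i => ProbabilityTheory.gaussianReal 0 (S.errVar i))
    (f := fun t => t) aestronglyMeasurable_id).trans ProbabilityTheory.integral_id_gaussianReal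

lemma margZ_eq (S : GaussianSEM V D) (Z : Set V) :
    S.margZ Z = S.noise.map fun e (i : Z) => ((1 - S.coef)⁻¹ *ᵥ e) i.1 := by
  unfold margZ obs
  rw [Measure.map_map (by fun_prop) (by fun_prop)]
  rfl

lemma integrable_margZ_eval (S : GaussianSEM V D) (Z : Set V) (i : Z) :
    Integrable (fun z : Z → ℝ => z i) (S.margZ Z) := by
  have hm : Measurable fun z : Z → ℝ => z i := measurable_pi_apply i
  rw [margZ_eq, integrable_map_measure hm.aestronglyMeasurable (by fun_prop)]
  simp only [Function.comp_def, Matrix.mulVec, dotProduct]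
  exact integrable_finsetSum _ fun j _ => (S.integrable_noise_eval j).const_mul _

lemma integral_margZ_eval (S : GaussianSEM V D) (Z : Set V) (i : Z) :
    ∫ z, z i ∂S.margZ Z = 0 := by
  have hm : Measurable fun z : Z → ℝ => z i := measurable_pi_apply i
  rw [margZ_eq, integral_map (by fun_prop) hm.aestronglyMeasurable]
  simp only [Matrix.mulVec, dotProduct]
  rw [integral_finsetSum _ fun j _ => (S.integrable_noise_eval j).const_mul _]
  simp [integral_const_mul, integral_noise_eval]

instance (S : GaussianSEM V D) (Z : Set V) : IsProbabilityMeasure (S.margZ Z) := by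
  rw [margZ_eq]
  exact Measure.isProbabilityMeasure_map (by fun_prop)

/-- Since the conditional mean is linear and `Z` has mean zero, integrating over `Z` amounts
to evaluating at `Z = 0`. -/
lemma adjIntegral_eq (S : GaussianSEM V D) (X Z : Set V) (x : V → ℝ) (y : V) :
    S.adjIntegral X Z x y = S.condExp y (X ∪ Z) fun i => if i ∈ Z then 0 else x i := by
  have hint : ∀ i : V, Integrable
      (fun z : Z → ℝ => if h : i ∈ Z then z ⟨i, h⟩ else x i) (S.margZ Z) := by
    intro i
    by_cases h : i ∈ Z
    · simpa [h] using S.integrable_margZ_eval Z ⟨i, h⟩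
    · simp [h]
  have hval : ∀ i : V,
      ∫ z : Z → ℝ, (if h : i ∈ Z then z ⟨i, h⟩ else x i) ∂S.margZ Z =
        if i ∈ Z then 0 else x i := by
    intro i
    by_cases h : i ∈ Z
    · simpa [h] using S.integral_margZ_eval Z ⟨i, h⟩
    · simp [h]
  unfold adjIntegral condExp
  simp only [Matrix.mulVec, dotProduct]
  rw [integral_finsetSum]
  · refine Finset.sum_congr rfl fun i _ => ?_
    rw [integral_const_mul, integral_finsetSum]
    · simp only [integral_const_mul, hval]
    · exact fun j _ => (hint _).const_mul _
  · exact fun i _ => (integrable_finsetSum _ fun j _ => (hint _).const_mul _).const_mul _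

end GaussianSEM

/-- A linear SEM (coefficients `coef`, error variances `var`) all of whose edges lie inside `U`,
together with its mean `mean` given `X = 1, Z = 0`, the residuals `res` of that mean divided by
the error variances, and its interventional mean `doMean`.  Stationarity of the mean is only
required off `E`, so that `E = X ∪ Z` characterizes the conditional mean. -/
structure MeanSystem {V : Type} [Fintype V] [DecidableEq V] (D : DAG V) (X Z E U : Set V) where
  coef : Matrix V V ℝ
  var : V → ℝ
  mean : V → ℝ
  res : V → ℝ
  doMean : V → ℝ
  compat : ∀ i j, coef j i ≠ 0 → D.Edge i j
  var_pos : ∀ v, 0 < var v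
  mean_row : ∀ v, mean v = ∑ u, coef v u * mean u + var v * res v
  res_col : ∀ v ∉ E, res v = ∑ c, coef c v * res c
  mean_X : ∀ v ∈ X, mean v = 1
  mean_Z : ∀ v ∈ Z, mean v = 0
  doMean_X : ∀ v ∈ X, doMean v = 1
  doMean_row : ∀ v ∉ X, doMean v = ∑ u, coef v u * doMean u
  row_eq_zero : ∀ v ∉ U, ∀ u, coef v u = 0
  col_eq_zero : ∀ v ∉ U, ∀ c, coef c v = 0

namespace MeanSystem

open Function

variable {V : Type} [Fintype V] [DecidableEq V] {D : DAG V} {X Z E U : Set V}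

lemma sum_mul_update_of_eq_zero (a f : V → ℝ) (u : V) (t : ℝ) (h : a u = 0) :
    ∑ x, a x * update f u t x = ∑ x, a x * f x := by
  refine Finset.sum_congr rfl fun x _ => ?_
  by_cases hx : x = u
  · simp [hx, h]
  · simp [hx]

lemma sum_add_single_row (A : Matrix V V ℝ) (f : V → ℝ) (u v w : V) :
    ∑ x, (A + Matrix.single u v 1 : Matrix V V ℝ) w x * f x =
      ∑ x, A w x * f x + if w = u then f v else 0 := by
  simp only [Matrix.add_apply, add_mul, Finset.sum_add_distrib, Matrix.single_apply]
  congr 1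
  by_cases h : w = u
  · subst h; simp
  · simp [h, Ne.symm h]

lemma sum_add_single_col (A : Matrix V V ℝ) (f : V → ℝ) (u v w : V) :
    ∑ x, (A + Matrix.single u v 1 : Matrix V V ℝ) x w * f x =
      ∑ x, A x w * f x + if w = v then f u else 0 := by
  have := sum_add_single_row A.transpose f v u w
  simpa [Matrix.add_apply, Matrix.single_apply, and_comm] using this

lemma coef_add_single_compat (S : MeanSystem D X Z E U) {v u : V} (h : D.Edge v u) (i j : V)
    (hij : (S.coef + Matrix.single u v 1 : Matrix V V ℝ) j i ≠ 0) : D.Edge i j := by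
  by_cases hc : u = j ∧ v = i
  · exact hc.1 ▸ hc.2 ▸ h
  · refine S.compat i j ?_
    simpa [Matrix.add_apply, Matrix.single_apply, hc] using hij

/-- Given the conditional and interventional means disagree at `y`, the SEM witnesses that `Z`
is not an adjustment set. -/
lemma exists_sem_ne (S : MeanSystem D X Z (X ∪ Z) U) (hXZ : Disjoint X Z) (y : V)
    (hy : S.mean y ≠ S.doMean y) :
    ∃ T : GaussianSEM V D,
      (Z = ∅ → T.doMean X (fun _ => 1) y ≠ T.condExp y X (fun _ => 1)) ∧
      (Z ≠ ∅ → T.doMean X (fun _ => 1) y ≠ T.adjIntegral X Z (fun _ => 1) y) := by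
  let T : GaussianSEM V D :=
    { coef := S.coef
      errVar := fun i => ⟨S.var i, (S.var_pos i).le⟩
      compat := S.compat
      errVar_pos := fun i => S.var_pos i }
  have hdo : T.doMean X (fun _ => 1) y = S.doMean y :=
    T.doMean_eq_of_rows X _ _ S.doMean_X S.doMean_row y
  refine ⟨T, fun hZ => ?_, fun _ => ?_⟩
  · subst hZ
    rw [hdo, T.condExp_eq_of_residual X _ S.mean S.res S.mean_row
      (fun v hv => S.res_col v (by simpa using hv)) S.mean_X y]
    exact hy.symm
  · rw [hdo, T.adjIntegral_eq, T.condExp_eq_of_residual (X ∪ Z) _ S.mean S.res S.mean_row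
      S.res_col ?_ y]
    · exact hy.symm
    · rintro v (hv | hv)
      · simp [S.mean_X v hv, hXZ.notMem_of_mem_left hv]
      · simp [S.mean_Z v hv, hv]

/-- The system without edges. -/
noncomputable def isolated (D : DAG V) (X Z : Set V) (hXZ : Disjoint X Z) (hE : X ⊆ E) :
    MeanSystem D X Z E X where
  coef := 0
  var := 1
  mean := X.indicator 1
  res := X.indicator 1
  doMean := X.indicator 1
  compat := by simp
  var_pos := by simp
  mean_row := by simp
  res_col := fun v hv => by
    have : v ∉ X := fun h => hv (hE h)
    simp [this]
  mean_X := fun v hv => by simp [hv]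
  mean_Z := fun v hv => by simp [hXZ.notMem_of_mem_right hv]
  doMean_X := fun v hv => by simp [hv]
  doMean_row := fun v hv => by simp [hv]
  row_eq_zero := by simp
  col_eq_zero := by simp

/-- Attach a new node `u` below a used node `v`. -/
lemma exists_forward (S : MeanSystem D X Z E U) {v u : V} (hvu : D.Edge v u) (hv : v ∈ U)
    (hu : u ∉ U) (huX : u ∉ X) (E' : Set V) (mu lu du : ℝ) (hdu : 0 < du)
    (hmu : mu = S.mean v + du * lu) (huZ : u ∈ Z → mu = 0)
    (hE : ∀ w ∉ E', w ≠ v → w ≠ u → w ∉ E)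
    (hEv : v ∉ E' → S.res v = ∑ c, S.coef c v * S.res c + lu) (hEu : u ∉ E' → lu = 0) :
    ∃ T : MeanSystem D X Z E' (insert u U),
      (∀ w ≠ u, T.mean w = S.mean w ∧ T.res w = S.res w ∧ T.doMean w = S.doMean w) ∧
      T.mean u = mu ∧ T.res u = lu ∧ T.doMean u = S.doMean v ∧ ∀ c, T.coef c u = 0 := by
  have hne : v ≠ u := fun h => hu (h ▸ hv)
  have hrow := S.row_eq_zero u hu
  have hcol := S.col_eq_zero u hu
  refine ⟨{ coef := S.coef + Matrix.single u v 1
            var := update S.var u du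
            mean := update S.mean u mu
            res := update S.res u lu
            doMean := update S.doMean u (S.doMean v)
            compat := S.coef_add_single_compat hvu
            var_pos := ?_
            mean_row := ?_
            res_col := ?_
            mean_X := ?_
            mean_Z := ?_
            doMean_X := ?_
            doMean_row := ?_
            row_eq_zero := ?_
            col_eq_zero := ?_ }, ?_, ?_, ?_, ?_, ?_⟩
  · intro w
    by_cases h : w = u
    · simp [h, hdu]
    · simp [h, S.var_pos w]
  · intro w
    rw [sum_add_single_row, sum_mul_update_of_eq_zero _ _ _ _ (hcol w)]
    by_cases h : w = u
    · subst h; simp [hrow, hne, hmu]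
    · simpa [h] using S.mean_row w
  · intro w hw
    rw [sum_add_single_col, sum_mul_update_of_eq_zero (fun x => S.coef x w) _ _ _ (hrow w)]
    by_cases h : w = u
    · subst h; simp [hcol, hne.symm, hEu hw]
    · by_cases h' : w = v
      · subst h'; simp [hne, ← hEv hw]
      · simpa [h, h'] using S.res_col w (hE w hw h' h)
  · intro w hw
    rw [update_of_ne (fun h : w = u => huX (h ▸ hw)), S.mean_X w hw]
  · intro w hw
    by_cases h : w = u
    · subst h; simp [huZ hw]
    · simp [h, S.mean_Z w hw]
  · intro w hw
    rw [update_of_ne (fun h : w = u => huX (h ▸ hw)), S.doMean_X w hw]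
  · intro w hw
    rw [sum_add_single_row, sum_mul_update_of_eq_zero _ _ _ _ (hcol w)]
    by_cases h : w = u
    · subst h; simp [hrow, hne]
    · simpa [h] using S.doMean_row w hw
  · intro w hw x
    have hw' : u ≠ w := fun h => hw (h ▸ Set.mem_insert _ _)
    simp [hw', S.row_eq_zero w fun h => hw (Set.mem_insert_of_mem _ h)]
  · intro w hw x
    have hw' : v ≠ w := fun h => hw (h ▸ Set.mem_insert_of_mem _ hv)
    simp [hw', S.col_eq_zero w fun h => hw (Set.mem_insert_of_mem _ h)]
  · intro w hw; simp [hw]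
  · simp
  · simp
  · simp
  · intro c; simp [hcol, hne]

/-- Split off part of the noise of `v` into a new parent `u` of `v`. -/
lemma exists_backward (S : MeanSystem D X Z E U) {v u : V} (huv : D.Edge u v) (hv : v ∈ U)
    (hu : u ∉ U) (huX : u ∉ X) (huZ : u ∉ Z) :
    ∃ T : MeanSystem D X Z E (insert u U),
      (∀ w, w ≠ u → T.res w = S.res w) ∧ T.res u = S.res v ∧ ∀ x, T.coef u x = 0 := by
  have hne : v ≠ u := fun h => hu (h ▸ hv)
  have hrow := S.row_eq_zero u hu
  have hcol := S.col_eq_zero u hu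
  refine ⟨{ coef := S.coef + Matrix.single v u 1
            var := update (update S.var v (S.var v / 2)) u (S.var v / 2)
            mean := update S.mean u (S.var v / 2 * S.res v)
            res := update S.res u (S.res v)
            doMean := update S.doMean u 0
            compat := S.coef_add_single_compat huv
            var_pos := ?_
            mean_row := ?_
            res_col := ?_
            mean_X := ?_
            mean_Z := ?_
            doMean_X := ?_
            doMean_row := ?_
            row_eq_zero := ?_
            col_eq_zero := ?_ }, ?_, ?_, ?_⟩
  · intro w
    by_cases h : w = u
    · simp [h, S.var_pos v]
    · by_cases h' : w = v
      · subst h'; simp [h, S.var_pos w]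
      · simp [h, h', S.var_pos w]
  · intro w
    rw [sum_add_single_row, sum_mul_update_of_eq_zero _ _ _ _ (hcol w)]
    by_cases h : w = u
    · subst h; simp [hrow, hne.symm]
    · by_cases h' : w = v
      · subst h'; simp [h]; linarith [S.mean_row w]
      · simpa [h, h'] using S.mean_row w
  · intro w hw
    rw [sum_add_single_col, sum_mul_update_of_eq_zero (fun x => S.coef x w) _ _ _ (hrow w)]
    by_cases h : w = u
    · subst h; simp [hcol, hne]
    · simpa [h] using S.res_col w hw
  · intro w hw
    rw [update_of_ne (fun h : w = u => huX (h ▸ hw)), S.mean_X w hw]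
  · intro w hw
    rw [update_of_ne (fun h : w = u => huZ (h ▸ hw)), S.mean_Z w hw]
  · intro w hw
    rw [update_of_ne (fun h : w = u => huX (h ▸ hw)), S.doMean_X w hw]
  · intro w hw
    rw [sum_add_single_row, sum_mul_update_of_eq_zero _ _ _ _ (hcol w)]
    by_cases h : w = u
    · subst h; simp [hrow, hne.symm]
    · simpa [h] using S.doMean_row w hw
  · intro w hw x
    have hw' : v ≠ w := fun h => hw (h ▸ Set.mem_insert_of_mem _ hv)
    simp [hw', S.row_eq_zero w fun h => hw (Set.mem_insert_of_mem _ h)]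
  · intro w hw x
    have hw' : u ≠ w := fun h => hw (h ▸ Set.mem_insert _ _)
    simp [hw', S.col_eq_zero w fun h => hw (Set.mem_insert_of_mem _ h)]
  · intro w hw; simp [hw]
  · simp
  · intro x; simp [hrow, hne]

/-- At a root `s`, halve the residual and double the variance. -/
lemma exists_halve (S : MeanSystem D X Z E U) {s : V} (hs : ∀ x, S.coef s x = 0) (hsE : s ∉ E) :
    ∃ T : MeanSystem D X Z (insert s E) U,
      T.mean = S.mean ∧ T.doMean = S.doMean ∧ T.coef = S.coef ∧
      T.res = update S.res s (S.res s / 2) ∧ ∑ c, T.coef c s * T.res c = S.res s := by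
  refine ⟨{ coef := S.coef
            var := update S.var s (2 * S.var s)
            mean := S.mean
            res := update S.res s (S.res s / 2)
            doMean := S.doMean
            compat := S.compat
            var_pos := ?_
            mean_row := ?_
            res_col := ?_
            mean_X := S.mean_X
            mean_Z := S.mean_Z
            doMean_X := S.doMean_X
            doMean_row := S.doMean_row
            row_eq_zero := S.row_eq_zero
            col_eq_zero := S.col_eq_zero }, rfl, rfl, rfl, rfl, ?_⟩
  · intro w
    by_cases h : w = s
    · simp [h, S.var_pos s]
    · simp [h, S.var_pos w]
  · intro w
    by_cases h : w = s
    · subst h; have := S.mean_row w; simp at this ⊢; linarith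
    · simpa [h] using S.mean_row w
  · intro w hw
    have hw' : w ≠ s := fun h => hw (h ▸ Set.mem_insert _ _)
    rw [sum_mul_update_of_eq_zero (fun x => S.coef x w) _ _ _ (hs w)]
    simpa [hw'] using S.res_col w fun h => hw (Set.mem_insert_of_mem _ h)
  · rw [sum_mul_update_of_eq_zero (fun x => S.coef x s) _ _ _ (hs s)]
    exact (S.res_col s hsE).symm

lemma mean_eq_of_row_eq_zero (S : MeanSystem D X Z E U) {s : V} (hs : ∀ x, S.coef s x = 0) :
    S.mean s = S.var s * S.res s := by
  simpa [hs] using S.mean_row s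

lemma doMean_eq_zero_of_row_eq_zero (S : MeanSystem D X Z E U) {s : V} (hs : ∀ x, S.coef s x = 0)
    (hsX : s ∉ X) : S.doMean s = 0 := by
  simpa [hs] using S.doMean_row s hsX

/-- Attach `u` below `v`, letting the residual `lu` of `u` balance the stationarity of `v`. -/
lemma exists_descend {v u : V} (S : MeanSystem D X Z (insert v (X ∪ Z)) U) (hvu : D.Edge v u)
    (hv : v ∈ U) (hu : u ∉ U) (huX : u ∉ X) (lu : ℝ) (hlu : S.mean v * lu < 0)
    (hres : v ∉ X → S.res v = ∑ c, S.coef c v * S.res c + lu) :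
    ∃ T : MeanSystem D X Z (insert u (X ∪ Z)) (insert u U),
      (∀ w ≠ u, T.mean w = S.mean w ∧ T.res w = S.res w ∧ T.doMean w = S.doMean w) ∧
      (u ∈ Z ∨ T.mean u = S.mean v / 2) ∧ T.res u = lu ∧ T.doMean u = S.doMean v ∧
      ∀ c, T.coef c u = 0 := by
  have hl : lu ≠ 0 := by rintro rfl; simp at hlu
  have hpos : 0 < -(S.mean v / lu) := by
    have : -(S.mean v / lu) = -(S.mean v * lu) / (lu * lu) := by field_simp
    rw [this]
    exact div_pos (by linarith) (mul_self_pos.2 hl)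
  have hE : ∀ w ∉ insert u (X ∪ Z), w ≠ v → w ≠ u → w ∉ insert v (X ∪ Z) := by
    intro w hw hwv _ hw'
    exact hw (Set.mem_insert_of_mem _ (hw'.resolve_left hwv))
  have hEv : v ∉ insert u (X ∪ Z) → S.res v = ∑ c, S.coef c v * S.res c + lu :=
    fun h => hres fun h' => h (Set.mem_insert_of_mem _ (Or.inl h'))
  have hEu : u ∉ insert u (X ∪ Z) → lu = 0 := fun h => (h (Set.mem_insert _ _)).elim
  by_cases huZ : u ∈ Z
  · obtain ⟨T, h, -, h'⟩ := S.exists_forward hvu hv hu huX (insert u (X ∪ Z)) 0 lu _ hpos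
      (by field_simp; ring) (fun _ => rfl) hE hEv hEu
    exact ⟨T, h, Or.inl huZ, h'⟩
  · obtain ⟨T, h, hm, h'⟩ := S.exists_forward hvu hv hu huX (insert u (X ∪ Z)) (S.mean v / 2) lu _
      (half_pos hpos) (by field_simp; ring) (fun h => (huZ h).elim) hE hEv hEu
    exact ⟨T, h, Or.inr hm, h'⟩

/-- Attach `u` below `v`, copying the mean of `v`. -/
lemma exists_extend {v u : V} (S : MeanSystem D X Z (X ∪ Z) U) (hvu : D.Edge v u)
    (hv : v ∈ U) (hu : u ∉ U) (huX : u ∉ X) (huZ : u ∈ Z → S.mean v = 0) :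
    ∃ T : MeanSystem D X Z (X ∪ Z) (insert u U),
      (∀ w ≠ u, T.mean w = S.mean w ∧ T.res w = S.res w ∧ T.doMean w = S.doMean w) ∧
      T.mean u = S.mean v ∧ T.doMean u = S.doMean v := by
  obtain ⟨T, h, hm, -, hd, -⟩ := S.exists_forward hvu hv hu huX (X ∪ Z) (S.mean v) 0 1 one_pos
    (by simp) huZ (fun w hw _ _ => hw) (fun h => by simpa using S.res_col v h) (fun _ => rfl)
  exact ⟨T, h, hm, hd⟩

end MeanSystem

namespace DAG

open Relation

variable {V : Type} [Fintype V] [DecidableEq V]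

/-- An edge whose head avoids `X`. -/
def Down (D : DAG V) (X : Set V) (a b : V) : Prop := D.Edge a b ∧ b ∉ X

lemma reflTransGen_of_down {D : DAG V} {X : Set V} {a b : V}
    (h : ReflTransGen (D.Down X) a b) : ReflTransGen D.Edge a b :=
  ReflTransGen.mono (fun _ _ h => h.1) _ _ h

/-- A node outside `X` which is reached from `X`, and reaches both `Z` and `Y`, along directed
paths that avoid `X`. -/
def IsFork (D : DAG V) (X Y Z : Set V) (w : V) : Prop :=
  w ∉ X ∧ (∃ x ∈ X, ReflTransGen (D.Down X) x w) ∧ (∃ z ∈ Z, ReflTransGen (D.Down X) w z) ∧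
    ∃ y ∈ Y, ReflTransGen (D.Down X) w y

lemma exists_maximal_isFork {D : DAG V} {X Y Z : Set V} (h : ∃ w, D.IsFork X Y Z w) :
    ∃ w, D.IsFork X Y Z w ∧ ∀ u, TransGen D.Edge w u → ¬ D.IsFork X Y Z u := by
  have hwf : WellFounded (Function.swap (TransGen D.Edge)) := by
    have : Std.Irrefl (Function.swap (TransGen D.Edge)) := ⟨fun v h => D.acyclic v h⟩
    have : IsTrans V (Function.swap (TransGen D.Edge)) := ⟨fun _ _ _ h h' => h'.trans h⟩
    exact Finite.wellFounded_of_trans_of_irrefl _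
  obtain ⟨w, hw, hmin⟩ := hwf.has_min {w | D.IsFork X Y Z w} h
  exact ⟨w, hw, fun u hu hf => hmin u hf hu⟩

end DAG

namespace MeanSystem

open Relation

variable {V : Type} [Fintype V] [DecidableEq V] {D : DAG V} {X Y Z E U : Set V}

/-- The state of the construction of a directed path from `x` after arriving at `v`: either `v`
still has to be balanced by a child, or its mean already vanishes. -/
def Descending (S : MeanSystem D X Z E U) (x v : V) : Prop :=
  v ∈ U ∧ S.doMean v = 1 ∧
  (∀ u ∈ U, u ∈ X ∨ ReflTransGen (D.Down X) x u ∧ ReflTransGen (D.Down X) u v) ∧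
  (E = insert v (X ∪ Z) ∧ 0 < S.mean v ∧ (v ∉ X → S.mean v < 1) ∧
      (∃ lu < 0, v ∉ X → S.res v = ∑ c, S.coef c v * S.res c + lu) ∨
    E = X ∪ Z ∧ S.mean v = 0)

lemma notMem_of_edge {x v u : V} (hvu : D.Edge v u) (huX : u ∉ X)
    (hU : ∀ u ∈ U, u ∈ X ∨ ReflTransGen (D.Down X) x u ∧ ReflTransGen (D.Down X) u v) :
    u ∉ U := by
  intro h
  rcases hU u h with h | h
  · exact huX h
  · exact D.acyclic v (TransGen.head' hvu (DAG.reflTransGen_of_down h.2))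

lemma Descending.exists_next {S : MeanSystem D X Z E U} {x v u : V} (hS : S.Descending x v)
    (hxv : ReflTransGen (D.Down X) x v) (hvu : D.Edge v u) (huX : u ∉ X) :
    ∃ (E' : Set V) (T : MeanSystem D X Z E' (insert u U)), T.Descending x u ∧ u ∉ U ∧
      T.mean u < 1 ∧ ∀ w ≠ u, T.mean w = S.mean w ∧ T.doMean w = S.doMean w := by
  obtain ⟨hvU, hd, hU, h⟩ := hS
  have hu : u ∉ U := notMem_of_edge hvu huX hU
  have hU' : ∀ w ∈ insert u U,
      w ∈ X ∨ ReflTransGen (D.Down X) x w ∧ ReflTransGen (D.Down X) w u := by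
    rintro w (rfl | hw)
    · exact Or.inr ⟨hxv.tail ⟨hvu, huX⟩, .refl⟩
    · exact (hU w hw).imp_right fun h => ⟨h.1, h.2.tail ⟨hvu, huX⟩⟩
  rcases h with ⟨rfl, hm, hm1, lu, hlu, hres⟩ | ⟨rfl, hm⟩
  · obtain ⟨T, hT, hmu, hru, hdu, hcol⟩ :=
      S.exists_descend hvu hvU hu huX lu (mul_neg_of_pos_of_neg hm hlu) hres
    have hv1 : S.mean v ≤ 1 := by
      by_cases hvX : v ∈ X
      · exact (S.mean_X v hvX).le
      · exact (hm1 hvX).le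
    refine ⟨_, T, ⟨Set.mem_insert _ _, hdu.trans hd, hU', ?_⟩, hu, ?_,
      fun w hw => ⟨(hT w hw).1, (hT w hw).2.2⟩⟩
    · by_cases huZ : u ∈ Z
      · exact Or.inr ⟨Set.insert_eq_of_mem (Or.inr huZ), T.mean_Z u huZ⟩
      · have hmu := hmu.resolve_left huZ
        exact Or.inl ⟨rfl, by linarith, fun _ => by linarith, lu, hlu, fun _ => by simp [hcol, hru]⟩
    · rcases hmu with huZ | hmu
      · simp [T.mean_Z u huZ]
      · linarith
  · obtain ⟨T, hT, hmu, hdu⟩ := S.exists_extend hvu hvU hu huX fun _ => hm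
    exact ⟨_, T, ⟨Set.mem_insert _ _, hdu.trans hd, hU', Or.inr ⟨rfl, hmu.trans hm⟩⟩, hu,
      by linarith, fun w hw => ⟨(hT w hw).1, (hT w hw).2.2⟩⟩

lemma exists_descending_from (hXZ : Disjoint X Z) {x v : V} (hx : x ∈ X)
    (h : ReflTransGen (D.Down X) x v) :
    ∃ (E U : Set V) (S : MeanSystem D X Z E U), S.Descending x v ∧ (v ∉ X → S.mean v < 1) := by
  induction h with
  | refl =>
    refine ⟨X ∪ Z, X, isolated D X Z hXZ Set.subset_union_left,
      ⟨hx, doMean_X _ _ hx, fun u hu => Or.inl hu, Or.inl ⟨?_, ?_, fun h => (h hx).elim, -1,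
        by norm_num, fun h => (h hx).elim⟩⟩, fun h => (h hx).elim⟩
    · exact (Set.insert_eq_of_mem (Set.mem_union_left Z hx)).symm
    · rw [mean_X _ _ hx]; exact one_pos
  | tail hxv hvu ih =>
    obtain ⟨E, U, S, hS, -⟩ := ih
    obtain ⟨E', T, hT, -, hm, -⟩ := hS.exists_next hxv hvu.1 hvu.2
    exact ⟨E', _, T, hT, fun _ => hm⟩

lemma exists_descending_through (hXZ : Disjoint X Z) {x w v : V} (hx : x ∈ X) (hw : w ∉ X)
    (hxw : ReflTransGen (D.Down X) x w) (hwv : ReflTransGen (D.Down X) w v) :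
    ∃ (E U : Set V) (S : MeanSystem D X Z E U), S.Descending x v ∧
      w ∈ U ∧ S.mean w < 1 ∧ S.doMean w = 1 := by
  induction hwv with
  | refl =>
    obtain ⟨E, U, S, hS, hm⟩ := exists_descending_from hXZ hx hxw
    exact ⟨E, U, S, hS, hS.1, hm hw, hS.2.1⟩
  | tail hwv hvu ih =>
    obtain ⟨E, U, S, hS, hwU, hm, hd⟩ := ih
    obtain ⟨E', T, hT, hu, -, hTS⟩ := hS.exists_next (hxw.trans hwv) hvu.1 hvu.2
    have := hTS w fun h => hu (h ▸ hwU)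
    exact ⟨E', _, T, hT, Or.inr hwU, by linarith, by linarith⟩

/-- If some fork exists, then conditioning on `Z` shrinks part of the causal effect. -/
lemma exists_mean_ne_of_isFork (hXZ : Disjoint X Z) (h : ∃ w, D.IsFork X Y Z w) :
    ∃ y ∈ Y, ∃ (U : Set V) (S : MeanSystem D X Z (X ∪ Z) U), S.mean y ≠ S.doMean y := by
  obtain ⟨w, ⟨hwX, ⟨x, hx, hxw⟩, ⟨z, hz, hwz⟩, ⟨y, hy, hwy⟩⟩, hmax⟩ := DAG.exists_maximal_isFork h
  have hnot : ∀ u z', z' ∈ Z → TransGen D.Edge w u → u ∉ X → ReflTransGen (D.Down X) x u →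
      ReflTransGen (D.Down X) u z' → ¬ ReflTransGen (D.Down X) u y :=
    fun u z' hz' hwu huX hxu huz huy =>
      hmax u hwu ⟨huX, ⟨x, hx, hxu⟩, ⟨z', hz', huz⟩, ⟨y, hy, huy⟩⟩
  suffices H : ∀ v, ReflTransGen (D.Down X) w v → ReflTransGen (D.Down X) v y →
      ∃ (U : Set V) (S : MeanSystem D X Z (X ∪ Z) U), v ∈ U ∧ S.mean v < 1 ∧ S.doMean v = 1 ∧
        ∀ u ∈ U, u ∈ X ∨ ReflTransGen (D.Down X) x u ∧ ReflTransGen (D.Down X) u z ∨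
          ReflTransGen (D.Down X) u v by
    obtain ⟨U, S, -, hm, hd, -⟩ := H y hwy .refl
    exact ⟨y, hy, U, S, by rw [hd]; exact hm.ne⟩
  intro v hwv
  induction hwv with
  | refl =>
    intro _
    obtain ⟨E, U, S, ⟨-, -, hU, hE⟩, hwU, hm, hd⟩ :=
      exists_descending_through hXZ hx hwX hxw hwz
    obtain rfl : E = X ∪ Z := by
      rcases hE with ⟨rfl, -⟩ | ⟨rfl, -⟩
      · exact Set.insert_eq_of_mem (Or.inr hz)
      · rfl
    exact ⟨U, S, hwU, hm, hd, fun u hu => (hU u hu).imp_right Or.inl⟩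
  | @tail v u hwv hvu ih =>
    intro huy
    obtain ⟨U, S, hvU, hm, hd, hU⟩ := ih (huy.head hvu)
    have hwu : TransGen D.Edge w u := TransGen.tail' (DAG.reflTransGen_of_down hwv) hvu.1
    have hxu : ReflTransGen (D.Down X) x u := (hxw.trans hwv).tail hvu
    have hu : u ∉ U := by
      intro h
      rcases hU u h with h | h | h
      · exact hvu.2 h
      · exact hnot u z hz hwu hvu.2 hxu h.2 huy
      · exact D.acyclic v (TransGen.head' hvu.1 (DAG.reflTransGen_of_down h))
    have huZ : u ∉ Z := fun h => hnot u u h hwu hvu.2 hxu .refl huy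
    obtain ⟨T, -, hmu, hdu⟩ := S.exists_extend hvu.1 hvU hu hvu.2 fun h => (huZ h).elim
    refine ⟨_, T, Set.mem_insert _ _, by linarith, by linarith, ?_⟩
    rintro t (rfl | ht)
    · exact Or.inr (Or.inr .refl)
    · exact (hU t ht).imp_right (Or.imp_right fun h => h.tail hvu)

end MeanSystem

/-- The position of a walk that leaves `X`: `causal v` if all edges so far point forward,
otherwise `down v` or `up v` according to the direction of the last edge. -/
inductive WalkState (V : Type)
  | causal (v : V)
  | down (v : V)
  | up (v : V)

namespace WalkState

open Relation

variable {V : Type} [Fintype V] [DecidableEq V] {D : DAG V} {X Y Z : Set V}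

/-- The node at which the walk is. -/
def node : WalkState V → V
  | causal v => v
  | down v => v
  | up v => v

/-- The steps of a walk that is open given `Z`, where a walk may also be reflected
at a node of `Z`, and a causal walk at a node of `X`. -/
inductive Step (D : DAG V) (X Z : Set V) : WalkState V → WalkState V → Prop
  | causal_causal {v u : V} : D.Edge v u → v ∉ Z → u ∉ X → Step D X Z (causal v) (causal u)
  | causal_up {v u : V} : D.Edge u v → v ∈ X ∪ Z → u ∉ X → u ∉ Z → Step D X Z (causal v) (up u)
  | up_up {v u : V} : D.Edge u v → u ∉ X → u ∉ Z → Step D X Z (up v) (up u)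
  | up_down {v u : V} : D.Edge v u → u ∉ X → Step D X Z (up v) (down u)
  | down_down {v u : V} : D.Edge v u → v ∉ Z → u ∉ X → Step D X Z (down v) (down u)
  | down_up {v u : V} : D.Edge u v → v ∈ Z → u ∉ X → u ∉ Z → Step D X Z (down v) (up u)

/-- The walk has arrived in `Y` and is not causal. -/
def IsTarget (Y : Set V) : WalkState V → Prop
  | causal _ => False
  | down v => v ∈ Y
  | up v => v ∈ Y

/-- The state can be reached from `X` in the given number of steps. -/
inductive ReachIn (D : DAG V) (X Z : Set V) : ℕ → WalkState V → Prop
  | start {x : V} : x ∈ X → ReachIn D X Z 0 (causal x)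
  | step {n : ℕ} {σ τ : WalkState V} : ReachIn D X Z n σ → Step D X Z σ τ → ReachIn D X Z (n + 1) τ

/-- A target can be reached from the state in the given number of steps. -/
inductive LeadsIn (D : DAG V) (X Y Z : Set V) : ℕ → WalkState V → Prop
  | target {σ : WalkState V} : IsTarget Y σ → LeadsIn D X Y Z 0 σ
  | step {n : ℕ} {σ τ : WalkState V} :
      Step D X Z σ τ → LeadsIn D X Y Z n τ → LeadsIn D X Y Z (n + 1) σ

lemma ReachIn.exists_isTarget {i l : ℕ} {σ : WalkState V} (h : ReachIn D X Z i σ)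
    (h' : LeadsIn D X Y Z l σ) : ∃ τ, ReachIn D X Z (i + l) τ ∧ IsTarget Y τ := by
  induction h' generalizing i with
  | target ht => exact ⟨_, h, ht⟩
  | @step l σ τ hs _ ih =>
    obtain ⟨τ, hτ⟩ := ih (h.step hs)
    exact ⟨τ, by rwa [show i + (l + 1) = i + 1 + l by omega]⟩

lemma ReachIn.exists_walk {n : ℕ} {τ : WalkState V} (h : ReachIn D X Z n τ) :
    ∃ s : ℕ → WalkState V, (∃ x ∈ X, s 0 = causal x) ∧
      (∀ i < n, Step D X Z (s i) (s (i + 1))) ∧ s n = τ := by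
  induction h with
  | @start x hx => exact ⟨fun _ => causal x, ⟨x, hx, rfl⟩, by simp, rfl⟩
  | @step n σ τ _ hs ih =>
    obtain ⟨s, h0, hstep, hn⟩ := ih
    refine ⟨fun i => if i ≤ n then s i else τ, by simpa using h0, fun i hi => ?_, by simp⟩
    rcases Nat.lt_succ_iff_lt_or_eq.1 hi with hi | rfl
    · simpa [hi.le, Nat.succ_le_of_lt hi] using hstep i hi
    · simpa [hn] using hs

lemma ReachIn.exists_down {n : ℕ} {v : V} (h : ReachIn D X Z n (causal v)) :
    ∃ x ∈ X, ReflTransGen (D.Down X) x v := by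
  generalize hσ : causal v = σ at h
  induction h generalizing v with
  | start hx => cases hσ; exact ⟨_, hx, .refl⟩
  | step _ hs ih =>
    subst hσ
    cases hs with
    | causal_causal he _ hX =>
      obtain ⟨x, hx, h⟩ := ih rfl
      exact ⟨x, hx, h.tail ⟨he, hX⟩⟩

lemma LeadsIn.up_of_down {l : ℕ} {v : V} (h : LeadsIn D X Y Z l (down v)) (hv : v ∉ Z) :
    LeadsIn D X Y Z l (up v) := by
  cases h with
  | target ht => exact .target ht
  | step hs h =>
    cases hs with
    | down_down he _ hX => exact .step (.up_down he hX) h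
    | down_up _ hZ _ _ => exact (hv hZ).elim

lemma LeadsIn.causal_of_down {l : ℕ} {v : V} (h : LeadsIn D X Y Z l (down v)) :
    LeadsIn D X Y Z l (causal v) ∨ ∃ y ∈ Y, ReflTransGen (D.Down X) v y := by
  generalize hσ : down v = σ at h
  induction h generalizing v with
  | target ht => subst hσ; exact Or.inr ⟨v, ht, .refl⟩
  | step hs h ih =>
    subst hσ
    cases hs with
    | down_down he hZ hX =>
      rcases ih rfl with h' | ⟨y, hy, h'⟩
      · exact Or.inl (.step (.causal_causal he hZ hX) h')
      · exact Or.inr ⟨y, hy, h'.head ⟨he, hX⟩⟩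
    | down_up he hZ hX hZ' => exact Or.inl (.step (.causal_up he (Or.inr hZ) hX hZ') h)

/-- From the `k`-th state on, the walk still traverses or has just traversed an edge backward. -/
def UpAhead (n : ℕ) (s : ℕ → WalkState V) (k : ℕ) : Prop := ∃ j, k ≤ j ∧ j ≤ n ∧ ∃ u, s j = up u

lemma UpAhead.of_succ {n k : ℕ} {s : ℕ → WalkState V} (h : UpAhead n s (k + 1)) :
    UpAhead n s k := by
  obtain ⟨j, hj, h⟩ := h
  exact ⟨j, by omega, h⟩

lemma UpAhead.succ {n k : ℕ} {s : ℕ → WalkState V} (h : UpAhead n s k)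
    (hk : ∀ v, s k ≠ up v) : UpAhead n s (k + 1) := by
  obtain ⟨j, hj, hjn, u, hu⟩ := h
  have : j ≠ k := by rintro rfl; exact hk u hu
  exact ⟨j, by omega, hjn, u, hu⟩

/-- A shortest walk from `X` to a target. -/
structure IsShortest (D : DAG V) (X Y Z : Set V) (n : ℕ) (s : ℕ → WalkState V) : Prop where
  start : ∃ x ∈ X, s 0 = causal x
  step : ∀ i < n, Step D X Z (s i) (s (i + 1))
  target : IsTarget Y (s n)
  le : ∀ i l σ, ReachIn D X Z i σ → LeadsIn D X Y Z l σ → n ≤ i + l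

lemma exists_isShortest (h : ∃ n τ, ReachIn D X Z n τ ∧ IsTarget Y τ) :
    ∃ n s, IsShortest D X Y Z n s := by
  obtain ⟨τ, hτ, ht⟩ := Nat.find_spec h
  obtain ⟨s, h0, hs, hn⟩ := hτ.exists_walk
  exact ⟨Nat.find h, s, h0, hs, hn ▸ ht, fun i l σ hr hl => Nat.find_min' h (hr.exists_isTarget hl)⟩

namespace IsShortest

variable {n : ℕ} {s : ℕ → WalkState V}

lemma reachIn (h : IsShortest D X Y Z n s) {i : ℕ} (hi : i ≤ n) : ReachIn D X Z i (s i) := by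
  induction i with
  | zero =>
    obtain ⟨x, hx, h0⟩ := h.start
    exact h0 ▸ .start hx
  | succ i ih => exact (ih (by omega)).step (h.step i hi)

lemma leadsIn (h : IsShortest D X Y Z n s) {i : ℕ} (hi : i ≤ n) :
    LeadsIn D X Y Z (n - i) (s i) := by
  induction hi using Nat.decreasingInduction with
  | self => simpa using LeadsIn.target h.target
  | of_succ i hi ih =>
    rw [show n - i = n - (i + 1) + 1 by omega]
    exact .step (h.step i hi) ih

lemma not_leadsIn (h : IsShortest D X Y Z n s) {j k : ℕ} (hjk : j < k) (hk : k ≤ n) :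
    ¬ LeadsIn D X Y Z (n - k) (s j) := by
  intro hl
  have := h.le _ _ _ (h.reachIn (i := j) (by omega)) hl
  omega

lemma causal_of_causal_succ (h : IsShortest D X Y Z n s) {j : ℕ} (hj : j < n) {u : V}
    (hu : s (j + 1) = causal u) : ∃ v, s j = causal v := by
  have hs := h.step j hj
  rw [hu] at hs
  generalize hσ : s j = σ at hs
  cases hs
  exact ⟨_, rfl⟩

lemma causal_of_causal (h : IsShortest D X Y Z n s) {j k : ℕ} (hjk : j ≤ k) (hk : k ≤ n)
    {u : V} (hu : s k = causal u) : ∃ v, s j = causal v := by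
  induction hjk using Nat.decreasingInduction with
  | self => exact ⟨u, hu⟩
  | of_succ j hj ih =>
    obtain ⟨v, hv⟩ := ih
    exact h.causal_of_causal_succ (by omega) hv

lemma upAhead_of_causal (h : IsShortest D X Y Z n s) {j : ℕ} (hj : j ≤ n) {v : V}
    (hv : s j = causal v) :
    UpAhead n s (j + 1) ∧ (v ∉ X → ∃ z ∈ Z, ReflTransGen (D.Down X) v z) := by
  induction hj using Nat.decreasingInduction generalizing v with
  | self => have := h.target; rw [hv] at this; exact this.elim
  | of_succ j hj ih =>
    have hs := h.step j hj
    rw [hv] at hs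
    generalize hτ : s (j + 1) = τ at hs
    cases hs with
    | causal_causal he _ hX =>
      obtain ⟨⟨k, hk, hk'⟩, hz⟩ := ih hτ
      obtain ⟨z, hz, hz'⟩ := hz hX
      exact ⟨⟨k, by omega, hk'⟩, fun _ => ⟨z, hz, hz'.head ⟨he, hX⟩⟩⟩
    | causal_up he hXZ _ _ =>
      exact ⟨⟨j + 1, le_rfl, hj, _, hτ⟩, fun hX => ⟨v, hXZ.resolve_left hX, .refl⟩⟩

lemma isFork_of_causal (h : IsShortest D X Y Z n s) {j : ℕ} (hj : j ≤ n) {v : V}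
    (hv : s j = causal v) (hvX : v ∉ X) (hy : ∃ y ∈ Y, ReflTransGen (D.Down X) v y) :
    D.IsFork X Y Z v :=
  ⟨hvX, (hv ▸ h.reachIn hj).exists_down, (h.upAhead_of_causal hj hv).2 hvX, hy⟩

lemma node_ne_of_down (h : IsShortest D X Y Z n s) (hF : ∀ w, ¬ D.IsFork X Y Z w) {j k : ℕ}
    (hjk : j < k) (hk : k ≤ n) {u : V} (hu : s k = down u) (huX : u ∉ X) : (s j).node ≠ u := by
  intro he
  have hl : LeadsIn D X Y Z (n - k) (down u) := hu ▸ h.leadsIn hk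
  have hn := h.not_leadsIn hjk hk
  have hr := h.reachIn (i := j) (by omega)
  generalize hσ : s j = σ at he hn hr
  cases σ with
  | causal v =>
    obtain rfl : v = u := he
    rcases hl.causal_of_down with hl | hl
    · exact hn hl
    · exact hF v (h.isFork_of_causal (by omega) hσ huX hl)
  | down v => obtain rfl : v = u := he; exact hn hl
  | up v =>
    obtain rfl : v = u := he
    refine hn (hl.up_of_down ?_)
    cases hr with
    | step _ hs => cases hs <;> assumption

lemma node_ne_of_causal (h : IsShortest D X Y Z n s) {j k : ℕ}
    (hjk : j < k) (hk : k ≤ n) {u : V} (hu : s k = causal u) : (s j).node ≠ u := by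
  intro he
  obtain ⟨v, hv⟩ := h.causal_of_causal hjk.le hk hu
  obtain rfl : v = u := by rwa [hv] at he
  exact h.not_leadsIn hjk hk (hv ▸ hu ▸ h.leadsIn hk)

lemma node_ne_of_up_down (h : IsShortest D X Y Z n s) (hF : ∀ w, ¬ D.IsFork X Y Z w) {j k : ℕ}
    (hjk : j < k) (hk : k < n) {v u : V} (hv : s k = up v) (hu : s (k + 1) = down u)
    (hvX : v ∉ X) (hvZ : v ∉ Z) : (s j).node ≠ v := by
  intro he
  have hs := h.step k hk
  have hl : LeadsIn D X Y Z (n - (k + 1)) (down u) := hu ▸ h.leadsIn hk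
  have hl' : LeadsIn D X Y Z (n - k) (up v) := hv ▸ h.leadsIn hk.le
  have hn := h.not_leadsIn hjk hk.le
  have hnk : n - k = n - (k + 1) + 1 := by omega
  rw [hv, hu] at hs
  obtain ⟨hvu, huX⟩ : D.Edge v u ∧ u ∉ X := by
    cases hs with
    | up_down h h' => exact ⟨h, h'⟩
  generalize hσ : s j = σ at he hn
  cases σ with
  | causal w =>
    obtain rfl : w = v := he
    rcases hl.causal_of_down with hl | ⟨y, hy, hl⟩
    · exact hn (hnk ▸ .step (.causal_causal hvu hvZ huX) hl)
    · exact hF w (h.isFork_of_causal (by omega) hσ hvX ⟨y, hy, hl.head ⟨hvu, huX⟩⟩)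
  | down w => obtain rfl : w = v := he; exact hn (hnk ▸ .step (.down_down hvu hvZ huX) hl)
  | up w => obtain rfl : w = v := he; exact hn hl'

lemma node_ne_of_up_target (h : IsShortest D X Y Z n s) (hF : ∀ w, ¬ D.IsFork X Y Z w)
    {j : ℕ} (hj : j < n) {y : V} (hn : s n = up y) (hyX : y ∉ X) : (s j).node ≠ y := by
  intro he
  have hy : y ∈ Y := by have := h.target; rwa [hn] at this
  have hc := h.not_leadsIn hj le_rfl
  rw [Nat.sub_self] at hc
  generalize hσ : s j = σ at he hc
  cases σ with
  | causal w =>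
    obtain rfl : w = y := he
    exact hF w (h.isFork_of_causal hj.le hσ hyX ⟨w, hy, .refl⟩)
  | down w => obtain rfl : w = y := he; exact hc (.target hy)
  | up w => obtain rfl : w = y := he; exact hc (.target hy)

lemma notMem_of_down (h : IsShortest D X Y Z n s) (hYZ : Disjoint Y Z) {k : ℕ} (hk : k ≤ n)
    {v : V} (hv : s k = down v) (hup : ¬ UpAhead n s k) : v ∉ Z := by
  rcases hk.lt_or_eq with hk | rfl
  · have hs := h.step k hk
    rw [hv] at hs
    generalize hτ : s (k + 1) = τ at hs
    cases hs with
    | down_down _ hZ _ => exact hZ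
    | down_up => exact (hup ⟨k + 1, by omega, hk, _, hτ⟩).elim
  · have := h.target
    rw [hv] at this
    exact hYZ.notMem_of_mem_left this

end IsShortest

end WalkState

namespace MeanSystem

open WalkState

variable {V : Type} [Fintype V] [DecidableEq V] {D : DAG V} {X Y Z E U : Set V}

/-- The stationarity of `v` can be restored by a child of `v` with residual `lu`. -/
def IsPending (S : MeanSystem D X Z E U) (v : V) : Prop :=
  ∃ lu, S.mean v * lu < 0 ∧ (v ∉ X → S.res v = ∑ c, S.coef c v * S.res c + lu)

/-- The system carries the mean along the first `k` steps of the walk `s` of length `n`. -/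
structure Tracks (S : MeanSystem D X Z E U) (n : ℕ) (s : ℕ → WalkState V) (k : ℕ) : Prop where
  node_mem : (s k).node ∈ U
  mem_or : ∀ v ∈ U, v ∈ X ∨ ∃ j ≤ k, (s j).node = v
  res_ne_zero : UpAhead n s k → ∀ v ∈ U, S.res v ≠ 0
  at_up : ∀ v, s k = up v → E = X ∪ Z ∧ ((∀ j < k, (s j).node ≠ v) → ∀ u, S.coef v u = 0)
  pending : ∀ v, s k = causal v ∨ s k = down v → UpAhead n s k →
    E = insert v (X ∪ Z) ∧ (v ∉ Z → S.IsPending v)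
  at_down : ∀ v, s k = down v → ¬ UpAhead n s k → E = X ∪ Z ∧ S.mean v ≠ 0 ∧ S.doMean v = 0

variable {n k : ℕ} {s : ℕ → WalkState V}

lemma mem_or_insert {u : V} (hU : ∀ v ∈ U, v ∈ X ∨ ∃ j ≤ k, (s j).node = v)
    (hu : (s (k + 1)).node = u) : ∀ v ∈ insert u U, v ∈ X ∨ ∃ j ≤ k + 1, (s j).node = v := by
  rintro v (rfl | hv)
  · exact Or.inr ⟨k + 1, le_rfl, hu⟩
  · exact (hU v hv).imp_right fun ⟨j, hj, h⟩ => ⟨j, by omega, h⟩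

lemma exists_tracks_of_pending {v u : V} (S : MeanSystem D X Z (insert v (X ∪ Z)) U)
    (hS : S.IsPending v) (hvu : D.Edge v u) (hv : v ∈ U) (huX : u ∉ X)
    (hu : s (k + 1) = causal u ∨ s (k + 1) = down u) (hnew : ∀ j ≤ k, (s j).node ≠ u)
    (hU : ∀ v ∈ U, v ∈ X ∨ ∃ j ≤ k, (s j).node = v) (hres : ∀ v ∈ U, S.res v ≠ 0)
    (hup : UpAhead n s (k + 1)) :
    ∃ (E' U' : Set V) (T : MeanSystem D X Z E' U'), T.Tracks n s (k + 1) := by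
  have hnode : (s (k + 1)).node = u := by rcases hu with h | h <;> rw [h] <;> rfl
  have huU : u ∉ U := fun h => by
    rcases hU u h with h | ⟨j, hj, h⟩
    · exact huX h
    · exact hnew j hj h
  obtain ⟨lu, hlu, hbal⟩ := hS
  obtain ⟨T, hT, hmu, hru, -, hcol⟩ := S.exists_descend hvu hv huU huX lu hlu hbal
  refine ⟨_, _, T, hnode ▸ Set.mem_insert _ _, mem_or_insert hU hnode, fun _ w hw => ?_,
    fun w hw => ?_, fun w hw _ => ?_, fun w _ h => (h hup).elim⟩
  · by_cases hwu : w = u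
    · rw [hwu, hru]
      rintro rfl
      simp at hlu
    · rw [(hT w hwu).2.1]
      exact hres w (hw.resolve_left hwu)
  · rcases hu with h | h <;> simp [h] at hw
  · obtain rfl : w = u := by
      rw [← hnode]
      rcases hw with h | h <;> rw [h] <;> rfl
    refine ⟨rfl, fun hwZ => ⟨lu, ?_, fun _ => by simp [hcol, hru]⟩⟩
    rw [hmu.resolve_left hwZ]
    linarith

lemma exists_tracks_of_balanced {v u : V} (S : MeanSystem D X Z (X ∪ Z) U)
    (hm : S.mean v ≠ 0) (hd : S.doMean v = 0) (hvu : D.Edge v u) (hv : v ∈ U) (huX : u ∉ X)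
    (huZ : u ∉ Z) (hu : s (k + 1) = down u) (hnew : ∀ j ≤ k, (s j).node ≠ u)
    (hU : ∀ v ∈ U, v ∈ X ∨ ∃ j ≤ k, (s j).node = v) (hup : ¬ UpAhead n s (k + 1)) :
    ∃ (E' U' : Set V) (T : MeanSystem D X Z E' U'), T.Tracks n s (k + 1) := by
  have hnode : (s (k + 1)).node = u := by rw [hu]; rfl
  have huU : u ∉ U := fun h => by
    rcases hU u h with h | ⟨j, hj, h⟩
    · exact huX h
    · exact hnew j hj h
  obtain ⟨T, -, hmu, hdu⟩ := S.exists_extend hvu hv huU huX fun h => (huZ h).elim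
  refine ⟨_, _, T, hnode ▸ Set.mem_insert _ _, mem_or_insert hU hnode, fun h => (hup h).elim,
    fun w hw => ?_, fun w _ h => (hup h).elim, fun w hw _ => ?_⟩
  · simp [hu] at hw
  · obtain rfl : u = w := by simpa [hu] using hw
    exact ⟨rfl, hmu ▸ hm, hdu.trans hd⟩

lemma exists_tracks_up {v u : V} (S : MeanSystem D X Z (X ∪ Z) U) (huv : D.Edge u v)
    (hv : v ∈ U) (huX : u ∉ X) (huZ : u ∉ Z) (hu : s (k + 1) = up u)
    (hU : ∀ v ∈ U, v ∈ X ∨ ∃ j ≤ k, (s j).node = v) (hres : ∀ v ∈ U, S.res v ≠ 0) :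
    ∃ (E' U' : Set V) (T : MeanSystem D X Z E' U'), T.Tracks n s (k + 1) := by
  have hnode : (s (k + 1)).node = u := by rw [hu]; rfl
  by_cases huU : u ∈ U
  · refine ⟨_, _, S, hnode ▸ huU, fun w hw => mem_or_insert hU hnode w (Or.inr hw),
      fun _ => hres, fun w hw => ⟨rfl, fun hnew => ?_⟩, fun w hw => ?_, fun w hw => ?_⟩
    · obtain rfl : u = w := by simpa [hu] using hw
      rcases hU u huU with h | ⟨j, hj, h⟩
      · exact (huX h).elim
      · exact (hnew j (by omega) h).elim
    · simp [hu] at hw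
    · simp [hu] at hw
  · obtain ⟨T, hT, hru, hrow⟩ := S.exists_backward huv hv huU huX huZ
    refine ⟨_, _, T, hnode ▸ Set.mem_insert _ _, mem_or_insert hU hnode, fun _ w hw => ?_,
      fun w hw => ⟨rfl, fun _ => ?_⟩, fun w hw => ?_, fun w hw => ?_⟩
    · by_cases hwu : w = u
      · rw [hwu, hru]
        exact hres v hv
      · rw [hT w hwu]
        exact hres w (hw.resolve_left hwu)
    · obtain rfl : u = w := by simpa [hu] using hw
      exact hrow
    · simp [hu] at hw
    · simp [hu] at hw

lemma Tracks.exists_succ {S : MeanSystem D X Z E U} (hS : S.Tracks n s k)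
    (h : IsShortest D X Y Z n s) (hF : ∀ w, ¬ D.IsFork X Y Z w) (hYZ : Disjoint Y Z)
    (hk : k < n) : ∃ (E' U' : Set V) (T : MeanSystem D X Z E' U'), T.Tracks n s (k + 1) := by
  obtain ⟨hnode, hU, hres, hup, hpend, hdown⟩ := hS
  have hs := h.step k hk
  have hr := h.reachIn hk.le
  have hnew : ∀ u, u ∉ X → s (k + 1) = causal u ∨ s (k + 1) = down u →
      ∀ j ≤ k, (s j).node ≠ u := by
    rintro u huX (hu | hu) j hj
    · exact h.node_ne_of_causal (by omega) hk hu
    · exact h.node_ne_of_down hF (by omega) hk hu huX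
  generalize hσ : s k = σ at hs hr hnode
  generalize hτ : s (k + 1) = τ at hs
  cases hs with
  | @causal_causal v u he hvZ huX =>
    have ha := (h.upAhead_of_causal hk.le hσ).1
    obtain ⟨rfl, hp⟩ := hpend v (Or.inl hσ) ha.of_succ
    exact S.exists_tracks_of_pending (hp hvZ) he hnode huX (Or.inl hτ) (hnew u huX (Or.inl hτ)) hU
      (hres ha.of_succ) ha
  | @causal_up v u he hvXZ huX huZ =>
    have ha := (h.upAhead_of_causal hk.le hσ).1.of_succ
    have hE := (hpend v (Or.inl hσ) ha).1
    rw [Set.insert_eq_of_mem hvXZ] at hE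
    subst hE
    exact S.exists_tracks_up he hnode huX huZ hτ hU (hres ha)
  | @up_up v u he huX huZ =>
    obtain ⟨rfl, -⟩ := hup v hσ
    exact S.exists_tracks_up he hnode huX huZ hτ hU (hres ⟨k, le_rfl, hk.le, v, hσ⟩)
  | @down_up v u he hvZ huX huZ =>
    have ha : UpAhead n s k := ⟨k + 1, by omega, hk, u, hτ⟩
    have hE := (hpend v (Or.inr hσ) ha).1
    rw [Set.insert_eq_of_mem (Set.mem_union_right X hvZ)] at hE
    subst hE
    exact S.exists_tracks_up he hnode huX huZ hτ hU (hres ha)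
  | @up_down v u he huX =>
    obtain ⟨rfl, hrow⟩ := hup v hσ
    have hres := hres ⟨k, le_rfl, hk.le, v, hσ⟩
    obtain ⟨hvX, hvZ⟩ : v ∉ X ∧ v ∉ Z := by
      cases hr with
      | step _ hs => cases hs <;> exact ⟨‹_›, ‹_›⟩
    have hrow := hrow fun j hj => h.node_ne_of_up_down hF hj hk hσ hτ hvX hvZ
    have hm := S.mean_eq_of_row_eq_zero hrow
    have hnew := hnew u huX (Or.inr hτ)
    by_cases ha : UpAhead n s (k + 1)
    · obtain ⟨T, hTm, -, hTc, hTr, hsum⟩ := S.exists_halve hrow (by simp [hvX, hvZ])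
      refine T.exists_tracks_of_pending ⟨-(S.res v / 2), ?_, fun _ => ?_⟩ he hnode huX (Or.inr hτ)
        hnew hU (fun w hw => ?_) ha
      · have := mul_pos (S.var_pos v) (mul_self_pos.2 (hres v hnode))
        rw [hTm, hm]
        linarith
      · rw [hsum, hTr]
        simp
        ring
      · by_cases hwv : w = v
        · simp [hTr, hwv, hres v hnode]
        · simp [hTr, hwv, hres w hw]
    · exact S.exists_tracks_of_balanced (hm ▸ mul_ne_zero (S.var_pos v).ne' (hres v hnode))
        (S.doMean_eq_zero_of_row_eq_zero hrow hvX) he hnode huX (h.notMem_of_down hYZ hk hτ ha) hτ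
        hnew hU ha
  | @down_down v u he hvZ huX =>
    have hnew := hnew u huX (Or.inr hτ)
    by_cases ha : UpAhead n s (k + 1)
    · obtain ⟨rfl, hp⟩ := hpend v (Or.inr hσ) ha.of_succ
      exact S.exists_tracks_of_pending (hp hvZ) he hnode huX (Or.inr hτ) hnew hU
        (hres ha.of_succ) ha
    · obtain ⟨rfl, hm, hd⟩ := hdown v hσ fun h => ha (h.succ (by simp [hσ]))
      exact S.exists_tracks_of_balanced hm hd he hnode huX (h.notMem_of_down hYZ hk hτ ha) hτ
        hnew hU ha

lemma exists_tracks (hXZ : Disjoint X Z) (h : IsShortest D X Y Z n s)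
    (hF : ∀ w, ¬ D.IsFork X Y Z w) (hYZ : Disjoint Y Z) (hk : k ≤ n) :
    ∃ (E U : Set V) (S : MeanSystem D X Z E U), S.Tracks n s k := by
  induction k with
  | zero =>
    obtain ⟨x, hx, h0⟩ := h.start
    refine ⟨X ∪ Z, X, isolated D X Z hXZ Set.subset_union_left, by rw [h0]; exact hx,
      fun v hv => Or.inl hv, fun _ v hv => by simp [isolated, hv], fun v hv => ?_,
      fun v hv _ => ?_, fun v hv => ?_⟩
    · simp [h0] at hv
    · obtain rfl : x = v := by simpa [h0] using hv
      exact ⟨(Set.insert_eq_of_mem (Set.mem_union_left Z hx)).symm,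
        fun _ => ⟨-1, by simp [mean_X _ _ hx], fun h => (h hx).elim⟩⟩
    · simp [h0] at hv
  | succ k ih =>
    obtain ⟨E, U, S, hS⟩ := ih (by omega)
    exact hS.exists_succ h hF hYZ hk

/-- If there is no fork, then a walk to a target transports a non-causal association. -/
lemma exists_mean_ne_of_walk (hXY : Disjoint X Y) (hXZ : Disjoint X Z) (hYZ : Disjoint Y Z)
    (hF : ∀ w, ¬ D.IsFork X Y Z w) (h : ∃ n τ, ReachIn D X Z n τ ∧ IsTarget Y τ) :
    ∃ y ∈ Y, ∃ (U : Set V) (S : MeanSystem D X Z (X ∪ Z) U), S.mean y ≠ S.doMean y := by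
  obtain ⟨n, s, h⟩ := exists_isShortest h
  obtain ⟨E, U, S, hnode, -, hres, hup, -, hdown⟩ := exists_tracks hXZ h hF hYZ le_rfl
  have ht := h.target
  generalize hσ : s n = σ at ht hnode
  cases σ with
  | causal y => exact ht.elim
  | down y =>
    obtain ⟨rfl, hm, hd⟩ := hdown y hσ fun ⟨j, hj, hjn, u, hu⟩ => by
      obtain rfl := le_antisymm hj hjn
      simp [hσ] at hu
    exact ⟨y, ht, U, S, by rwa [hd]⟩
  | up y =>
    have hyX : y ∉ X := hXY.notMem_of_mem_right ht
    obtain ⟨rfl, hrow⟩ := hup y hσ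
    have hrow := hrow fun j hj => h.node_ne_of_up_target hF hj hσ hyX
    refine ⟨y, ht, U, S, ?_⟩
    rw [S.doMean_eq_zero_of_row_eq_zero hrow hyX, S.mean_eq_of_row_eq_zero hrow]
    exact mul_ne_zero (S.var_pos y).ne' (hres ⟨n, le_rfl, le_rfl, y, hσ⟩ y hnode)

end MeanSystem

lemma List.IsChain.reflTransGen {α : Type*} {r : α → α → Prop} {a b : α} {l : List α}
    (h : List.IsChain r (a :: l)) (hb : b ∈ a :: l) : Relation.ReflTransGen r a b := by
  induction l generalizing a with
  | nil => obtain rfl : b = a := by simpa using hb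
           exact .refl
  | cons c l ih =>
    rw [List.isChain_cons_cons] at h
    rcases List.mem_cons.1 hb with rfl | hb
    · exact .refl
    · exact (ih h.2 hb).head h.1

lemma List.Nodup.neighbors_eq {α : Type*} {p : List α} (hp : p.Nodup) {a b c a' c' : α}
    (h : [a, b, c] <:+: p) (h' : [a', b, c'] <:+: p) : a = a' ∧ c = c' := by
  obtain ⟨s, t, rfl⟩ := h
  obtain ⟨s', t', h⟩ := h'
  have hlen : s'.length + 1 = s.length + 1 := by
    refine (hp.getElem_inj_iff (hi := ?_) (hj := by simp)).1 ?_
    · rw [← h]; simp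
    · have h1 : (s' ++ [a', b, c'] ++ t')[s'.length + 1]'(by simp) = b := by simp
      simp only [h] at h1
      rw [h1]
      simp
  obtain ⟨-, heq⟩ := List.append_inj (by simpa using h :
    s' ++ (a' :: b :: c' :: t') = s ++ (a :: b :: c :: t)) (by omega)
  simp only [List.cons.injEq] at heq
  exact ⟨heq.1.symm, heq.2.2.1.symm⟩

namespace DAG

open Relation WalkState

variable {V : Type} [Fintype V] [DecidableEq V] {D : DAG V} {X Y Z : Set V}

lemma not_edge_symm {a b : V} (h : D.Edge a b) : ¬ D.Edge b a :=
  fun h' => D.acyclic a (.tail (.single h) h')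

lemma isChain_down {a : V} {l : List V} (h : List.IsChain D.Edge (a :: l)) (hl : ∀ v ∈ l, v ∉ X) :
    List.IsChain (D.Down X) (a :: l) := by
  induction l generalizing a with
  | nil => simp
  | cons b l ih =>
    rw [List.isChain_cons_cons] at h ⊢
    exact ⟨⟨h.1, hl b (by simp)⟩, ih h.2 fun v hv => hl v (by simp [hv])⟩

lemma ProperCausalPath.exists_down {p : List V} (hp : D.ProperCausalPath X Y p) {w : V}
    (hw : w ∈ p) : (∃ x ∈ X, ReflTransGen (D.Down X) x w) ∧
      ∃ y ∈ Y, ReflTransGen (D.Down X) w y := by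
  obtain ⟨⟨x, hx, y, hy, -, -, hhead, hlast⟩, htail, hc⟩ := hp
  obtain ⟨l, rfl⟩ : ∃ l, p = x :: l := by
    cases p with
    | nil => simp at hhead
    | cons a l => exact ⟨l, by simpa using hhead⟩
  have hchain := isChain_down hc htail
  refine ⟨⟨x, hx, hchain.reflTransGen hw⟩, y, hy, ?_⟩
  obtain ⟨l₁, l₂, h⟩ := List.append_of_mem hw
  rw [h] at hchain hlast
  refine (hchain.right_of_append).reflTransGen (List.mem_of_getLast? ?_)
  rwa [List.getLast?_append_of_ne_nil _ (by simp)] at hlast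

lemma reachIn_up_of_desc {a z : V} (haz : ReflTransGen D.Edge a z) (hz : z ∈ Z) (haX : a ∉ X)
    (haZ : a ∉ Z)
    (h : (∃ n, ReachIn D X Z n (causal a)) ∨ ∃ n, ReachIn D X Z n (down a)) :
    ∃ n, ReachIn D X Z n (up a) := by
  induction haz using ReflTransGen.head_induction_on with
  | refl => exact (haZ hz).elim
  | @head a b hab _ ih =>
    by_cases hbX : b ∈ X
    · exact ⟨_, (ReachIn.start hbX).step (.causal_up hab (Or.inl hbX) haX haZ)⟩
    by_cases hbZ : b ∈ Z
    · rcases h with ⟨n, h⟩ | ⟨n, h⟩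
      · exact ⟨_, (h.step (.causal_causal hab haZ hbX)).step (.causal_up hab (Or.inr hbZ) haX haZ)⟩
      · exact ⟨_, (h.step (.down_down hab haZ hbX)).step (.down_up hab hbZ haX haZ)⟩
    · obtain ⟨n, h⟩ := ih hbX hbZ <| h.imp
        (fun ⟨n, h⟩ => ⟨_, h.step (.causal_causal hab haZ hbX)⟩)
        fun ⟨n, h⟩ => ⟨_, h.step (.down_down hab haZ hbX)⟩
      exact ⟨_, h.step (.up_up hab haX haZ)⟩

lemma exists_down_or_reachIn_up {w z : V} (hwz : ReflTransGen D.Edge w z) (hz : z ∈ Z)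
    (hwX : w ∉ X) : (∃ z ∈ Z, ReflTransGen (D.Down X) w z) ∨ ∃ n, ReachIn D X Z n (up w) := by
  induction hwz using ReflTransGen.head_induction_on with
  | refl => exact Or.inl ⟨z, hz, .refl⟩
  | @head w b hwb _ ih =>
    by_cases hwZ : w ∈ Z
    · exact Or.inl ⟨w, hwZ, .refl⟩
    by_cases hbX : b ∈ X
    · exact Or.inr ⟨_, (ReachIn.start hbX).step (.causal_up hwb (Or.inl hbX) hwX hwZ)⟩
    · rcases ih hbX with ⟨z, hz, h⟩ | ⟨n, h⟩
      · exact Or.inl ⟨z, hz, h.head ⟨hwb, hbX⟩⟩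
      · exact Or.inr ⟨_, h.step (.up_up hwb hwX hwZ)⟩

lemma exists_down_or_isTarget {v y : V} (hvy : ReflTransGen (D.Down X) v y) (hy : y ∈ Y)
    (h : ∃ n τ, ReachIn D X Z n τ ∧ (τ = up v ∨ τ = down v)) :
    (∃ z ∈ Z, ReflTransGen (D.Down X) v z) ∨ ∃ n τ, ReachIn D X Z n τ ∧ IsTarget Y τ := by
  induction hvy using ReflTransGen.head_induction_on with
  | refl =>
    obtain ⟨n, τ, h, rfl | rfl⟩ := h
    · exact Or.inr ⟨n, _, h, hy⟩
    · exact Or.inr ⟨n, _, h, hy⟩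
  | @head v b hvb _ ih =>
    by_cases hvZ : v ∈ Z
    · exact Or.inl ⟨v, hvZ, .refl⟩
    refine (ih ?_).imp_left fun ⟨z, hz, h⟩ => ⟨z, hz, h.head hvb⟩
    obtain ⟨n, τ, h, rfl | rfl⟩ := h
    · exact ⟨_, _, h.step (.up_down hvb.1 hvb.2), Or.inr rfl⟩
    · exact ⟨_, _, h.step (.down_down hvb.1 hvZ hvb.2), Or.inr rfl⟩

lemma exists_isFork_or_isTarget_of_forb (h : (Z ∩ D.Forb X Y).Nonempty) :
    (∃ w, D.IsFork X Y Z w) ∨ ∃ n τ, ReachIn D X Z n τ ∧ IsTarget Y τ := by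
  obtain ⟨z, hz, p, w, hp, hw, hwX, hwz⟩ := h
  obtain ⟨hx, y, hy, hwy⟩ := hp.exists_down hw
  have hfork : (∃ z ∈ Z, ReflTransGen (D.Down X) w z) → ∃ w, D.IsFork X Y Z w :=
    fun h => ⟨w, hwX, hx, h, y, hy, hwy⟩
  rcases exists_down_or_reachIn_up hwz hz hwX with h | ⟨n, h⟩
  · exact Or.inl (hfork h)
  · exact (exists_down_or_isTarget hwy hy ⟨n, _, h, Or.inl rfl⟩).imp_left hfork

lemma exists_isTarget_of_not_blocks (hXY : Disjoint X Y) (hYZ : Disjoint Y Z) (hXZ : Disjoint X Z)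
    {p : List V} (hp : D.ProperNonCausalPath X Y p) (hZ : ¬ D.Blocks Z p) :
    ∃ n τ, ReachIn D X Z n τ ∧ IsTarget Y τ := by
  obtain ⟨⟨x, hx, y, hy, hnodup, hadj, hhead, hlast⟩, htail, hc⟩ := hp
  simp only [Blocks, not_or, not_exists, not_and] at hZ
  obtain ⟨hnon, hcoll⟩ := hZ
  have hcoll : ∀ {a b c}, [a, b, c] <:+: p → D.Edge a b → D.Edge c b →
      ∃ z ∈ Z, ReflTransGen D.Edge b z := by
    intro a b c h hab hcb
    obtain ⟨z, ⟨_, rfl, hbz⟩, hz⟩ := Set.nonempty_iff_ne_empty.2 (hcoll b ⟨a, c, h, hab, hcb⟩)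
    exact ⟨z, hz, hbz⟩
  have hnon : ∀ {a b c}, [a, b, c] <:+: p → D.Edge b a ∨ D.Edge b c → b ∉ Z := by
    intro a b c h hb
    refine hnon b ⟨⟨a, c, h⟩, ?_⟩
    rintro ⟨a', c', h', hab, hcb⟩
    obtain ⟨rfl, rfl⟩ := hnodup.neighbors_eq h h'
    rcases hb with hb | hb
    · exact not_edge_symm hab hb
    · exact not_edge_symm hcb hb
  have hback : ∀ {l a b r}, p = l ++ a :: b :: r → D.Edge b a → b ∉ Z := by
    intro l a b r hp hba
    cases r with
    | nil =>
      obtain rfl : b = y := by simpa [hp] using hlast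
      exact hYZ.notMem_of_mem_left hy
    | cons c r => exact hnon (a := a) (c := c) ⟨l, r, by simp [hp]⟩ (Or.inl hba)
  have main : ∀ r l a b, p = l ++ a :: b :: r → b ∉ X →
      ((List.IsChain D.Edge (l ++ [a, b]) ∧ D.Edge a b ∧ ∃ n, ReachIn D X Z n (causal b)) ∨
        (D.Edge a b ∧ ∃ n, ReachIn D X Z n (down b)) ∨
        (D.Edge b a ∧ ∃ n, ReachIn D X Z n (up b))) →
      ∃ n τ, ReachIn D X Z n τ ∧ IsTarget Y τ := by
    intro r
    induction r with
    | nil =>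
      intro l a b hp hbX h
      obtain rfl : b = y := by simpa [hp] using hlast
      rcases h with ⟨h, -⟩ | ⟨-, n, h⟩ | ⟨-, n, h⟩
      · exact (hc (hp ▸ h)).elim
      · exact ⟨n, _, h, hy⟩
      · exact ⟨n, _, h, hy⟩
    | cons c r ih =>
      intro l a b hp hbX h
      have hinf : [a, b, c] <:+: p := ⟨l, r, by simp [hp]⟩
      have hp' : p = (l ++ [a]) ++ b :: c :: r := by simp [hp]
      have hcX : c ∉ X := by
        refine htail c ?_
        rw [hp]
        cases l <;> simp
      refine ih (l ++ [a]) b c hp' hcX ?_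
      have hbc : D.Adj b c := by
        have h := hadj
        rw [hp'] at h
        exact (List.isChain_cons_cons.1 h.right_of_append).1
      rcases hbc with hbc | hcb
      · have hbZ := hnon hinf (Or.inr hbc)
        rcases h with ⟨hch, hab, n, h⟩ | ⟨hab, n, h⟩ | ⟨hba, n, h⟩
        · refine Or.inl ⟨?_, hbc, _, h.step (.causal_causal hbc hbZ hcX)⟩
          rw [show l ++ [a, b] = l ++ [a] ++ [b] by simp] at hch
          rw [List.isChain_append] at hch
          rw [List.isChain_append]
          refine ⟨hch.1, by simpa using hbc, ?_⟩
          simpa using hab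
        · exact Or.inr (Or.inl ⟨hbc, _, h.step (.down_down hbc hbZ hcX)⟩)
        · exact Or.inr (Or.inl ⟨hbc, _, h.step (.up_down hbc hcX)⟩)
      · have hcZ := hback hp' hcb
        refine Or.inr (Or.inr ⟨hcb, ?_⟩)
        have key : D.Edge a b → ((∃ n, ReachIn D X Z n (causal b)) ∨
            ∃ n, ReachIn D X Z n (down b)) → ∃ n, ReachIn D X Z n (up c) := by
          intro hab h
          by_cases hbZ : b ∈ Z
          · rcases h with ⟨n, h⟩ | ⟨n, h⟩
            · exact ⟨_, h.step (.causal_up hcb (Or.inr hbZ) hcX hcZ)⟩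
            · exact ⟨_, h.step (.down_up hcb hbZ hcX hcZ)⟩
          · obtain ⟨z, hz, hbz⟩ := hcoll hinf hab hcb
            obtain ⟨n, h⟩ := reachIn_up_of_desc hbz hz hbX hbZ h
            exact ⟨_, h.step (.up_up hcb hcX hcZ)⟩
        rcases h with ⟨-, hab, h⟩ | ⟨hab, h⟩ | ⟨hba, n, h⟩
        · exact key hab (Or.inl h)
        · exact key hab (Or.inr h)
        · exact ⟨_, h.step (.up_up hcb hcX hcZ)⟩
  obtain ⟨l, hl⟩ : ∃ l, p = x :: l := by
    cases p with
    | nil => simp at hhead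
    | cons a l => exact ⟨l, by simpa using hhead⟩
  cases l with
  | nil =>
    obtain rfl : x = y := by simpa [hl] using hlast
    exact (hXY.notMem_of_mem_left hx hy).elim
  | cons b r =>
    have hbX : b ∉ X := htail b (by simp [hl])
    refine main r [] x b (by simp [hl]) hbX ?_
    have hxb : D.Adj x b := by
      have h := hadj
      rw [hl] at h
      exact (List.isChain_cons_cons.1 h).1
    rcases hxb with hxb | hbx
    · exact Or.inl ⟨by simpa using hxb, hxb, _, (ReachIn.start hx).step
        (.causal_causal hxb (hXZ.notMem_of_mem_left hx) hbX)⟩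
    · exact Or.inr (Or.inr ⟨hbx, _, (ReachIn.start hx).step
        (.causal_up hbx (Or.inl hx) hbX (hback (l := []) (by simpa using hl) hbx))⟩)

lemma exists_isFork_or_isTarget (hXY : Disjoint X Y) (hXZ : Disjoint X Z) (hYZ : Disjoint Y Z)
    (h : ¬ D.SatisfiesAC X Y Z) :
    (∃ w, D.IsFork X Y Z w) ∨ ∃ n τ, ReachIn D X Z n τ ∧ IsTarget Y τ := by
  by_cases hforb : Z ∩ D.Forb X Y = ∅
  · simp only [SatisfiesAC, hforb, true_and, not_forall] at h
    obtain ⟨p, hp, hZ⟩ := h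
    exact Or.inr (exists_isTarget_of_not_blocks hXY hYZ hXZ hp hZ)
  · exact exists_isFork_or_isTarget_of_forb (Set.nonempty_iff_ne_empty.2 hforb)

end DAG

/-- If `Z` does not satisfy the adjustment criterion relative to
`(X, Y)` in the DAG `D`, then there exist a linear Gaussian SEM compatible with `D` and
a node `y ∈ Y` such that `E[y | do(X = 1)] ≠ E[y | X = 1]` when `Z = ∅` and
`E[y | do(X = 1)] ≠ ∫ E[y | X = 1, Z = z] f_Z(z) dz` when `Z ≠ ∅`. -/
theorem adjustment_criterion_complete
    {V : Type} [Fintype V] [DecidableEq V]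
    (D : DAG V) (X Y Z : Set V)
    (hXY : Disjoint X Y) (hXZ : Disjoint X Z) (hYZ : Disjoint Y Z)
    (hX : X.Nonempty) (hY : Y.Nonempty)
    (hnAC : ¬ D.SatisfiesAC X Y Z) :
    ∃ (S : GaussianSEM V D), ∃ y ∈ Y,
      (Z = ∅ → S.doMean X (fun _ => 1) y ≠ S.condExp y X (fun _ => 1)) ∧
      (Z ≠ ∅ → S.doMean X (fun _ => 1) y ≠ S.adjIntegral X Z (fun _ => 1) y) := by
  obtain ⟨y, hy, U, S, hS⟩ : ∃ y ∈ Y, ∃ (U : Set V) (S : MeanSystem D X Z (X ∪ Z) U),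
      S.mean y ≠ S.doMean y := by
    by_cases hF : ∃ w, D.IsFork X Y Z w
    · exact MeanSystem.exists_mean_ne_of_isFork hXZ hF
    · exact MeanSystem.exists_mean_ne_of_walk hXY hXZ hYZ (not_exists.1 hF)
        ((DAG.exists_isFork_or_isTarget hXY hXZ hYZ hnAC).resolve_left hF)
  obtain ⟨T, hT⟩ := S.exists_sem_ne hXZ y hS
  exact ⟨T, y, hy, hT⟩
end

section
/- Let 𝐗 and 𝐘 be disjoint nonempty node sets in a DAG D, and let I be a node set with forb(𝐗,𝐘,D) ⊆ I and De(I,D) = I (I is descendral). Then there exists a set Z, disjoint from 𝐗 ∪ 𝐘, that satisfies the adjustment criterion relative to (𝐗,𝐘) in D with Z ∩ I = ∅ if and only if the set Adjust(𝐗,𝐘,D) \ I satisfies the adjustment criterion relative to (𝐗,𝐘) in D. -/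
attribute [local instance] Classical.propDecidable

namespace DAG

variable {V : Type} [Fintype V] [DecidableEq V]

theorem Edge.asymm {D : DAG V} {a b : V} (h : D.Edge a b) : ¬ D.Edge b a := fun h' =>
  D.acyclic a (.tail (.single h) h')

theorem Adj.symm {D : DAG V} {a b : V} (h : D.Adj a b) : D.Adj b a := Or.symm h

theorem nodup_of_isChain (D : DAG V) {l : List V} (h : l.IsChain D.Edge) : l.Nodup := by
  have h' : l.Pairwise (Relation.TransGen D.Edge) :=
    List.isChain_iff_pairwise.1 (h.imp fun _ _ e => .single e)
  refine h'.imp ?_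
  rintro a _ hab rfl
  exact D.acyclic a hab

theorem eq_and_eq_of_isInfix {α : Type*} {p : List α} (hp : p.Nodup) {a w b a' b' : α}
    (h : [a, w, b] <:+: p) (h' : [a', w, b'] <:+: p) : a = a' ∧ b = b' := by
  obtain ⟨s, t, rfl⟩ := h
  obtain ⟨s', t', h'⟩ := h'
  have e : (s' ++ [a']) ++ w :: (b' :: t') = (s ++ [a]) ++ w :: (b :: t) := by simpa using h'
  have h₁ : w ∉ s ++ [a] := by
    intro hw
    simp only [List.nodup_append, List.nodup_cons] at hp
    grind
  have h₂ : w ∉ b :: t := by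
    intro hw
    simp only [List.nodup_append, List.nodup_cons] at hp
    grind
  obtain ⟨h₃, -, h₄⟩ := (List.append_cons_inj_of_notMem h₁ h₂).1 e.symm
  exact ⟨by simpa using (List.append_inj' h₃ rfl).2, (List.cons.inj h₄).1⟩

theorem triple_infix_of_reverse {α : Type*} {p : List α} {a w b : α}
    (h : [a, w, b] <:+: p.reverse) :
    [b, w, a] <:+: p := by
  rw [← List.reverse_infix]; simpa using h

theorem exists_eq_append_cons_of_first {α : Type*} (S : Set α) {l : List α}
    (h : ∃ y ∈ l, y ∈ S) : ∃ q y r, l = q ++ y :: r ∧ y ∈ S ∧ ∀ v ∈ q, v ∉ S := by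
  induction l with
  | nil => simp at h
  | cons a l ih =>
    by_cases ha : a ∈ S
    · exact ⟨[], a, l, rfl, ha, by simp⟩
    · obtain ⟨q, y, r, rfl, hy, hq⟩ := ih (by grind)
      exact ⟨a :: q, y, r, rfl, hy, by grind⟩

/-- A connecting path in terms of its consecutive triples. -/
structure Connects (D : DAG V) (Z : Set V) (p : List V) : Prop where
  collider : ∀ a w b, [a, w, b] <:+: p → D.Edge a w → D.Edge b w →
    ∃ z ∈ Z, Relation.ReflTransGen D.Edge w z
  nonCollider : ∀ a w b, [a, w, b] <:+: p → ¬ (D.Edge a w ∧ D.Edge b w) → w ∉ Z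

theorem Connects.of_isInfix {D : DAG V} {Z : Set V} {p q : List V} (h : D.Connects Z p)
    (hq : q <:+: p) : D.Connects Z q :=
  ⟨fun a w b ht => h.1 a w b (ht.trans hq), fun a w b ht => h.2 a w b (ht.trans hq)⟩

theorem Connects.not_blocks {D : DAG V} {Z : Set V} {p : List V} (h : D.Connects Z p) :
    ¬ D.Blocks Z p := by
  rintro (⟨w, ⟨⟨a, b, ht⟩, hn⟩, hw⟩ | ⟨w, ⟨a, b, ht, ha, hb⟩, hw⟩)
  · exact h.2 a w b ht (fun hab => hn ⟨a, b, ht, hab⟩) hw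
  · obtain ⟨z, hz, hwz⟩ := h.1 a w b ht ha hb
    exact (Set.eq_empty_iff_forall_notMem.1 hw z) ⟨⟨w, rfl, hwz⟩, hz⟩

theorem connects_of_not_blocks {D : DAG V} {Z : Set V} {p : List V} (hp : p.Nodup)
    (h : ¬ D.Blocks Z p) : D.Connects Z p := by
  constructor
  · intro a w b ht ha hb
    by_contra hz
    refine h (.inr ⟨w, ⟨a, b, ht, ha, hb⟩, Set.eq_empty_iff_forall_notMem.2 ?_⟩)
    rintro z ⟨⟨w', rfl, hwz⟩, hz'⟩
    exact hz ⟨z, hz', hwz⟩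
  · intro a w b ht hn hw
    refine h (.inl ⟨w, ⟨⟨a, b, ht⟩, ?_⟩, hw⟩)
    rintro ⟨a', b', ht', he⟩
    obtain ⟨rfl, rfl⟩ := eq_and_eq_of_isInfix hp ht ht'
    exact hn he

/-- A path without colliders in a descendral set stays directed once it enters that set. -/
theorem isChain_edge_of_enters (D : DAG V) {I : Set V}
    (hI : ∀ a b, D.Edge a b → a ∈ I → b ∈ I) (r : List V) {u w : V}
    (hadj : (u :: w :: r).IsChain D.Adj) (huw : D.Edge u w) (hw : w ∈ I)
    (hcol : ∀ a v b, [a, v, b] <:+: u :: w :: r → D.Edge a v → D.Edge b v → v ∉ I) :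
    (u :: w :: r).IsChain D.Edge := by
  induction r generalizing u w with
  | nil => simpa using huw
  | cons b r ih =>
    simp only [List.isChain_cons_cons] at hadj
    have hwb : D.Edge w b := hadj.2.1.resolve_right fun hbw =>
      hcol u w b ⟨[], r, by simp⟩ huw hbw hw
    refine .cons_cons huw (ih (by simpa using hadj.2) hwb (hI _ _ hwb hw) ?_)
    exact fun a v c ht => hcol a v c (ht.trans (List.suffix_cons _ _).isInfix)

/-- Following an outgoing edge along a path leads to a collider or to the end of the path. -/
theorem mem_of_edge_out (D : DAG V) {A : Set V}
    (hA : ∀ a b, D.Edge a b → b ∈ A → a ∈ A) (r : List V) {w b : V}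
    (hadj : (w :: b :: r).IsChain D.Adj) (hwb : D.Edge w b)
    (hlast : ∀ z ∈ (w :: b :: r).getLast?, z ∈ A)
    (hcol : ∀ a v b', [a, v, b'] <:+: w :: b :: r → D.Edge a v → D.Edge b' v → v ∈ A) :
    w ∈ A := by
  induction r generalizing w b with
  | nil => exact hA _ _ hwb (hlast b (by simp))
  | cons c r ih =>
    simp only [List.isChain_cons_cons] at hadj
    refine hA _ _ hwb ?_
    rcases hadj.2.1 with hbc | hcb
    · exact ih (by simpa using hadj.2) hbc (fun z hz => hlast z (by simpa using hz))
        fun a v d ht => hcol a v d (ht.trans (List.suffix_cons _ _).isInfix)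
    · exact hcol w b c ⟨[], r, by simp⟩ hwb hcb

theorem mem_of_triple (D : DAG V) {A : Set V}
    (hA : ∀ a b, D.Edge a b → b ∈ A → a ∈ A) {p : List V} (hadj : p.IsChain D.Adj)
    (hhead : ∀ z ∈ p.head?, z ∈ A) (hlast : ∀ z ∈ p.getLast?, z ∈ A)
    (hcol : ∀ a v b, [a, v, b] <:+: p → D.Edge a v → D.Edge b v → v ∈ A)
    {a w b : V} (ht : [a, w, b] <:+: p) : w ∈ A := by
  have htr := hadj.infix ht
  simp only [List.isChain_cons_cons] at htr
  have key := ht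
  obtain ⟨s, t, rfl⟩ := ht
  by_cases hwb : D.Edge w b
  · have hs : w :: b :: t <:+ s ++ [a, w, b] ++ t := ⟨s ++ [a], by simp⟩
    exact D.mem_of_edge_out hA t (hadj.suffix hs) hwb
      (fun z hz => hlast z (by simpa using hz))
      fun c v d h => hcol c v d (h.trans hs.isInfix)
  by_cases hwa : D.Edge w a
  · have hs : w :: a :: s.reverse <:+ (s ++ [a, w, b] ++ t).reverse :=
      ⟨t.reverse ++ [b], by simp⟩
    have hadj' : (s ++ [a, w, b] ++ t).reverse.IsChain D.Adj :=
      List.isChain_reverse.2 (hadj.imp fun _ _ h => h.symm)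
    refine D.mem_of_edge_out hA _ (hadj'.suffix hs) hwa (fun z hz => hhead z ?_)
      fun c v d h hc hd => hcol d v c (triple_infix_of_reverse (h.trans hs.isInfix)) hd hc
    cases s <;> simpa [List.getLast?_cons] using hz
  · exact hcol a w b key (htr.1.resolve_right hwa) (htr.2.1.resolve_left hwb)

theorem exists_directed_to_first (D : DAG V) {S : Set V} {c v : V}
    (h : Relation.ReflTransGen D.Edge c v) (hv : v ∈ S) :
    ∃ l t, (l ++ [t]).IsChain D.Edge ∧ (l ++ [t]).head? = some c ∧ t ∈ S ∧ ∀ u ∈ l, u ∉ S := by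
  induction h using Relation.ReflTransGen.head_induction_on with
  | refl => exact ⟨[], v, by simp, by simp, hv, by simp⟩
  | @head a c hac _ ih =>
    by_cases ha : a ∈ S
    · exact ⟨[], a, by simp, by simp, ha, by simp⟩
    · obtain ⟨l, t, hc, hh, ht, hl⟩ := ih
      refine ⟨a :: l, t, ?_, by simp, ht, by grind⟩
      exact hc.cons (by simpa [hh] using hac)

theorem reachable_of_isChain (D : DAG V) {c w : V} {l : List V} (h : l.IsChain D.Edge)
    (hh : l.head? = some c) (hw : w ∈ l) : Relation.ReflTransGen D.Edge c w := by
  cases l with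
  | nil => simp at hw
  | cons a l =>
    obtain rfl : a = c := by simpa using hh
    rcases List.mem_cons.1 hw with rfl | hw
    · exact .refl
    · have h' : (a :: l).Pairwise (Relation.ReflTransGen D.Edge) :=
        List.isChain_iff_pairwise.1 (h.imp fun _ _ e => .single e)
      exact (List.pairwise_cons.1 h').1 w hw

/-- A non-causal path `x → c ← y` with `c` outside the forbidden set cannot be blocked when
`c` is an ancestor of `X ∪ Y`. -/
theorem not_satisfiesAC_of_collider (D : DAG V) {X Y Z : Set V} (hXY : Disjoint X Y)
    (hZ : Disjoint Z (X ∪ Y)) (hAC : D.SatisfiesAC X Y Z) {x c y : V} (hx : x ∈ X) (hy : y ∈ Y)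
    (hcX : c ∉ X) (hxy : x ≠ y) (hxc : D.Edge x c) (hyc : D.Edge y c) (hcF : c ∉ D.Forb X Y)
    (hcA : c ∈ D.Anc (X ∪ Y)) : False := by
  have hYX : ∀ v ∈ Y, v ∉ X := fun v h h' => Set.disjoint_left.1 hXY h' h
  obtain ⟨v, hv, hcv⟩ := hcA
  obtain ⟨l, t, hl, hh, ht, hlS⟩ := D.exists_directed_to_first hcv hv
  have hreach := fun w => D.reachable_of_isChain (w := w) hl hh
  have hcl : c ∈ l ++ [t] := List.mem_of_mem_head? hh
  rcases ht with ht | ht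
  · have hchain : (y :: (l ++ [t])).IsChain D.Edge := hl.cons (by simpa [hh] using hyc)
    have hnd := D.nodup_of_isChain hchain
    have hb := hAC.2 (y :: (l ++ [t])).reverse ⟨⟨t, ht, y, hy, ?_⟩, ?_, ?_⟩
    · rcases hb with ⟨w, ⟨⟨a, b, hw⟩, -⟩, hwZ⟩ | ⟨w, ⟨a, b, hw, ha, hb⟩, -⟩
      · have hwl : w ∈ l ++ [t] := by
          have hmem : w ∈ y :: (l ++ [t]) := by
            have := hw.subset (a := w) (by simp)
            simpa only [List.mem_reverse] using this
          rcases List.mem_cons.1 hmem with rfl | h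
          · exact (Set.disjoint_left.1 hZ hwZ (.inr hy)).elim
          · exact h
        refine Connects.not_blocks (p := [x, c, y]) ⟨?_, ?_⟩ (hAC.2 [x, c, y]
          ⟨⟨x, hx, y, hy, ⟨?_, ?_, rfl, rfl⟩⟩, ?_, ?_⟩)
        · intro a' w' b' ht' _ _
          obtain ⟨rfl, rfl, rfl⟩ : a' = x ∧ w' = c ∧ b' = y := by
            simpa using ht'.eq_of_length (by simp)
          exact ⟨w, hwZ, hreach w hwl⟩
        · intro a' w' b' ht' hn
          obtain ⟨rfl, rfl, rfl⟩ : a' = x ∧ w' = c ∧ b' = y := by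
            simpa using ht'.eq_of_length (by simp)
          exact (hn ⟨hxc, hyc⟩).elim
        · have h1 : x ≠ c := fun h => hcX (h ▸ hx)
          have h2 : c ≠ y := by
            rintro rfl
            exact hyc.asymm hyc
          simp [h1, h2, hxy]
        · change List.IsChain _ _
          simp [Adj, hxc, hyc]
        · simpa [hcX] using hYX y hy
        · change ¬ List.IsChain _ _
          simpa [hxc] using hyc.asymm
      · have := hchain.infix (triple_infix_of_reverse hw)
        simp only [List.isChain_cons_cons] at this
        exact this.2.1.asymm ha
    · refine ⟨List.nodup_reverse.2 hnd, ?_, by simp, by simp [-List.reverse_cons]⟩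
      exact List.isChain_reverse.2 (hchain.imp fun _ _ h => Or.inr h)
    · intro v hv
      have : v = y ∨ v ∈ l := by simpa [or_comm] using hv
      rcases this with rfl | h
      · exact hYX v hy
      · exact fun h' => hlS v h (.inl h')
    · intro h
      have h' := List.isChain_reverse.1 (show List.IsChain _ _ from h)
      have h1 : D.Edge c y := h'.rel_head? (by simp [hh])
      exact h1.asymm hyc
  · have hchain : (x :: (l ++ [t])).IsChain D.Edge := hl.cons (by simpa [hh] using hxc)
    refine hcF ⟨x :: (l ++ [t]), c, ⟨⟨x, hx, t, ht, D.nodup_of_isChain hchain, ?_, rfl, ?_⟩,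
      ?_, hchain⟩, List.mem_cons_of_mem _ hcl, hcX, .refl⟩
    · exact hchain.imp fun _ _ h => Or.inl h
    · simp [List.getLast?_cons]
    · intro v hv
      rcases List.mem_append.1 (show v ∈ l ++ [t] from hv) with h | h
      · exact fun h' => hlS v h (.inl h')
      · exact hYX v ((List.mem_singleton.1 h).symm ▸ ht)

/-- A proper non-causal path without colliders in `I` can be cut at its first node in `Y`. -/
theorem exists_nonCausal_initial_segment (D : DAG V) {X Y I : Set V} (hXY : Disjoint X Y)
    (hforb : D.Forb X Y ⊆ I) (hI : ∀ a b, D.Edge a b → a ∈ I → b ∈ I) {p : List V}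
    (hp : D.ProperNonCausalPath X Y p)
    (hcol : ∀ a w b, [a, w, b] <:+: p → D.Edge a w → D.Edge b w → w ∉ I) :
    ∃ q y, D.ProperNonCausalPath X Y (q ++ [y]) ∧ y ∈ Y ∧ (∀ v ∈ q, v ∉ Y) ∧
      (q ++ [y]) <+: p := by
  obtain ⟨⟨x, hx, y₀, hy₀, hnd, hadj, hh, hl⟩, hprop, hnc⟩ := hp
  replace hadj : p.IsChain D.Adj := hadj
  have hYX : ∀ v ∈ Y, v ∉ X := fun v h h' => Set.disjoint_left.1 hXY h' h
  obtain ⟨q, y, r, rfl, hy, hq⟩ := exists_eq_append_cons_of_first Y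
    ⟨y₀, List.mem_of_mem_getLast? hl, hy₀⟩
  have hpre : q ++ [y] <+: q ++ y :: r := ⟨r, by simp⟩
  have hq0 : q ≠ [] := by
    rintro rfl
    obtain rfl : y = x := by simpa using hh
    exact hYX _ hy hx
  have hhq : (q ++ [y]).head? = some x := by cases q <;> simp_all
  have hpath : D.IsPathFrom (q ++ [y]) x y :=
    ⟨hnd.sublist hpre.sublist, hadj.prefix hpre, hhq, by simp⟩
  have hprop' : ∀ v ∈ (q ++ [y]).tail, v ∉ X := by
    intro v hv
    refine hprop v ?_
    cases q with
    | nil => simp at hv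
    | cons a q => simp at hv ⊢; tauto
  refine ⟨q, y, ⟨⟨x, hx, y, hy, hpath⟩, hprop', fun hc => hnc ?_⟩, hy, hq, hpre⟩
  have hyI : y ∈ I := hforb ⟨q ++ [y], y, ⟨⟨x, hx, y, hy, hpath⟩, hprop', hc⟩, by simp,
    hYX y hy, .refl⟩
  obtain ⟨q, u, rfl⟩ : ∃ q' u, q = q' ++ [u] :=
    ⟨q.dropLast, q.getLast hq0, (List.dropLast_append_getLast hq0).symm⟩
  have hc' : (q ++ [u, y]).IsChain D.Edge := by
    simpa using (show List.IsChain D.Edge _ from hc)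
  have hs : u :: y :: r <:+ q ++ [u] ++ y :: r := ⟨q, by simp⟩
  have huy : D.Edge u y := by
    simpa using hc'.suffix (l₁ := [u, y]) ⟨q, rfl⟩
  have := D.isChain_edge_of_enters hI r (hadj.suffix hs) huy hyI
    fun a v b h => hcol a v b (h.trans hs.isInfix)
  have h3 := List.IsChain.append_overlap (l₁ := q) (l₂ := [u, y]) (l₃ := r) hc'
    (by simpa using this) (by simp)
  change List.IsChain _ _
  simpa using h3

/-- Let `I ⊇ forb(X,Y,D)` be descendral in `D`.  Then there exists a
set `Z`, disjoint from `X ∪ Y`, that satisfies the adjustment criterion relative to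
`(X, Y)` in `D` with `Z ∩ I = ∅` iff `Adjust(X,Y,D) \ I` satisfies the adjustment
criterion relative to `(X, Y)` in `D`. -/
theorem constructive_adjustment_set
    (D : DAG V) (X Y I : Set V)
    (hXY : Disjoint X Y) (hX : X.Nonempty) (hY : Y.Nonempty)
    (hforb : D.Forb X Y ⊆ I) (hdescendral : D.Desc I = I) :
    (∃ Z, Disjoint Z (X ∪ Y) ∧ D.SatisfiesAC X Y Z ∧ Z ∩ I = ∅) ↔
      D.SatisfiesAC X Y (D.AdjustSet X Y \ I) := by
  constructor
  swap
  · intro h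
    refine ⟨_, Set.disjoint_left.2 fun v hv hv' => hv.1.2 (.inl hv'), h, ?_⟩
    exact Set.eq_empty_iff_forall_notMem.2 fun v hv => hv.1.2 hv.2
  rintro ⟨Z, hZ, hAC, hZI⟩
  refine ⟨Set.eq_empty_iff_forall_notMem.2 fun v hv => hv.1.1.2 (.inr hv.2), ?_⟩
  intro p hp
  by_contra hnb
  have hdesc : ∀ a b, a ∈ I → Relation.ReflTransGen D.Edge a b → b ∈ I := fun a b ha h =>
    hdescendral ▸ ⟨a, ha, h⟩
  have hI : ∀ a b, D.Edge a b → a ∈ I → b ∈ I := fun a b h ha => hdesc a b ha (.single h)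
  have hA : ∀ a b, D.Edge a b → b ∈ D.Anc (X ∪ Y) → a ∈ D.Anc (X ∪ Y) :=
    fun a b h ⟨v, hv, hbv⟩ => ⟨v, hv, .head h hbv⟩
  have hnd : p.Nodup := by
    obtain ⟨⟨x, -, y, -, h, -⟩, -⟩ := hp
    exact h
  have hcon := connects_of_not_blocks hnd hnb
  have hcolI : ∀ a w b, [a, w, b] <:+: p → D.Edge a w → D.Edge b w → w ∉ I := by
    intro a w b ht ha hb hw
    obtain ⟨z, hz, hwz⟩ := hcon.1 a w b ht ha hb
    exact hz.2 (hdesc w z hw hwz)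
  have hcolA : ∀ a w b, [a, w, b] <:+: p → D.Edge a w → D.Edge b w → w ∈ D.Anc (X ∪ Y) := by
    intro a w b ht ha hb
    obtain ⟨z, hz, hwz⟩ := hcon.1 a w b ht ha hb
    obtain ⟨v, hv, hzv⟩ := hz.1.1
    exact ⟨v, hv, hwz.trans hzv⟩
  obtain ⟨q, y, hq, hy, hqY, hpre⟩ := D.exists_nonCausal_initial_segment hXY hforb hI hp hcolI
  replace hcolI := fun a w b h => hcolI a w b (List.IsInfix.trans h hpre.isInfix)
  replace hcolA := fun a w b h => hcolA a w b (List.IsInfix.trans h hpre.isInfix)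
  replace hcon := hcon.of_isInfix hpre.isInfix
  have hq' := hq
  obtain ⟨⟨x, hx, y', -, hqnd, hadj, hh, hl⟩, hprop, -⟩ := hq'
  obtain rfl : y = y' := by simpa using hl
  replace hadj : (q ++ [y]).IsChain D.Adj := hadj
  have hinX : ∀ a w b, [a, w, b] <:+: q ++ [y] → w ∉ X := by
    rintro a w b ⟨s, t, h⟩
    refine hprop w ?_
    rw [← h]
    cases s <;> simp
  have hinY : ∀ a w b, [a, w, b] <:+: q ++ [y] → w ∉ Y := by
    rintro a w b ⟨s, t, h⟩
    refine hqY w ?_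
    have : (s ++ [a, w, b] ++ t).dropLast = q := by rw [h]; simp
    rw [← this]
    rcases List.eq_nil_or_concat t with rfl | ⟨t, u, rfl⟩
    · simp [List.dropLast_append_of_ne_nil]
    · simp [List.dropLast_append_of_ne_nil]
  have hncI : ∀ a w b, [a, w, b] <:+: q ++ [y] → ¬ (D.Edge a w ∧ D.Edge b w) → w ∈ I := by
    intro a w b ht hn
    by_contra hw
    refine hcon.2 a w b ht hn ⟨⟨D.mem_of_triple hA hadj ?_ ?_ hcolA ht, ?_⟩, hw⟩
    · intro z hz
      obtain rfl : x = z := by simpa [hh] using hz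
      exact ⟨x, .inl hx, .refl⟩
    · intro z hz
      obtain rfl : y = z := by simpa using hz
      exact ⟨y, .inr hy, .refl⟩
    · rintro ((h | h) | h)
      · exact hinX a w b ht h
      · exact hinY a w b ht h
      · exact hw (hforb h)
  by_cases hcol : ∃ a c b, [a, c, b] <:+: q ++ [y] ∧ D.Edge a c ∧ D.Edge b c
  · obtain ⟨a, c, b, ht, hac, hbc⟩ := hcol
    have hc := hcolI a c b ht hac hbc
    have hcX := hinX a c b ht
    have hcA := hcolA a c b ht hac hbc
    obtain ⟨s, t, h⟩ := ht
    obtain rfl : s = [] := by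
      rcases List.eq_nil_or_concat s with rfl | ⟨s, a', rfl⟩
      · rfl
      · exact (hc (hI a c hac (hncI a' a c ⟨s, b :: t, by simpa using h⟩
          fun he => he.2.asymm hac))).elim
    obtain rfl : t = [] := by
      rcases t with _ | ⟨b', t⟩
      · rfl
      · exact (hc (hI b c hbc (hncI c b b' ⟨[a], t, by simpa using h⟩
          fun he => he.1.asymm hbc))).elim
    rw [← h] at hh hl
    obtain rfl : a = x := by simpa using hh
    obtain rfl : b = y := by simpa using hl
    exact D.not_satisfiesAC_of_collider hXY hZ hAC hx hy hcX
      (fun e => Set.disjoint_left.1 hXY hx (e ▸ hy)) hac hbc (fun h => hc (hforb h)) hcA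
  · push Not at hcol
    refine Connects.not_blocks ⟨?_, ?_⟩ (hAC.2 _ hq)
    · exact fun a w b ht ha hb => (hcol a w b ht ha hb).elim
    · intro a w b ht hn hw
      exact Set.eq_empty_iff_forall_notMem.1 hZI w ⟨hw, hncI a w b ht hn⟩

end DAG
end

section
/- Let 𝐗 and 𝐘 be disjoint nonempty node sets in a DAG D, and let 𝐗' ⊆ 𝐗 be such that there is no causal path from a node of 𝐗 \ 𝐗' to a node of 𝐘 containing no node of 𝐗 other than its first node. Then: (1) for every strictly positive joint probability mass function f consistent with the causal DAG D and every assignment x to 𝐗 with restriction x' to 𝐗': f(y | do(x)) = f(y) if 𝐗' = ∅, and f(y | do(x)) = f(y | do(x')) otherwise, for all y; and (2) if 𝐗' ≠ ∅ and Z (disjoint from 𝐗 ∪ 𝐘) satisfies the adjustment criterion relative to (𝐗,𝐘) in D, then Z satisfies the adjustment criterion relative to (𝐗',𝐘) in D. -/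
attribute [local instance] Classical.propDecidable

namespace DAG

variable {V : Type} [Fintype V] [DecidableEq V]

section PMF

variable {A : Type} [Fintype A] [DecidableEq A]

/-- the marginal probability of the event `{w | w = v on S}` under the pmf `f` -/
noncomputable def marg (f : (V → A) → ℝ) (S : Set V) (v : V → A) : ℝ :=
  ∑ w : V → A, if ∀ i ∈ S, w i = v i then f w else 0

/-- the conditional probability `f(s | t)` of the values of `v` on `S` given those on `T` -/
noncomputable def condP (f : (V → A) → ℝ) (S T : Set V) (v : V → A) : ℝ :=
  marg f (S ∪ T) v / marg f T v

/-- the parents of a node -/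
def parents (D : DAG V) (i : V) : Set V := {j | D.Edge j i}

/-- `f` is a strictly positive joint pmf consistent with the causal DAG `D`:
it is positive, sums to one, and factorizes according to `D`. -/
def IsConsistent (D : DAG V) (f : (V → A) → ℝ) : Prop :=
  (∀ v, 0 < f v) ∧ (∑ v : V → A, f v = 1) ∧
  (∀ v, f v = ∏ i : V, condP f {i} (D.parents i) v)

/-- the interventional pmf `f(v | do(X = x))`, defined by truncated factorization -/
noncomputable def doPMF (D : DAG V) (f : (V → A) → ℝ) (X : Set V) (x : V → A)
    (v : V → A) : ℝ :=
  if ∀ i ∈ X, v i = x i then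
    ∏ i : V, if i ∈ X then 1 else condP f {i} (D.parents i) v
  else 0

/-- the adjustment formula `∑_z f(y | x, z) f(z)`, where the values of `X` and `Y`
are read off from the assignment `a` (coordinates outside `Z` are pinned to `a`) -/
noncomputable def adjFormula (f : (V → A) → ℝ) (X Y Z : Set V) (a : V → A) : ℝ :=
  ∑ w : V → A, if ∀ i, i ∉ Z → w i = a i then condP f Y (X ∪ Z) w * marg f Z w else 0

end PMF

end DAG


namespace DAG

variable {V : Type} [Fintype V] [DecidableEq V]

section PMF

variable {A : Type} [Fintype A] [DecidableEq A]

theorem marg_congr (f : (V → A) → ℝ) {S : Set V} {v w : V → A}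
    (h : ∀ i ∈ S, v i = w i) : marg f S v = marg f S w := by
  unfold marg
  refine Finset.sum_congr rfl fun u _ => ?_
  have : (∀ i ∈ S, u i = v i) ↔ (∀ i ∈ S, u i = w i) :=
    forall₂_congr fun i hi => by rw [h i hi]
  simp only [this]

theorem condP_congr (f : (V → A) → ℝ) {S T : Set V} {v w : V → A}
    (h : ∀ i ∈ S ∪ T, v i = w i) : condP f S T v = condP f S T w := by
  unfold condP
  rw [marg_congr f h, marg_congr f fun i hi => h i (Or.inr hi)]

theorem marg_pos {f : (V → A) → ℝ} (hf : ∀ v, 0 < f v) (S : Set V) (v : V → A) :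
    0 < marg f S v := by
  unfold marg
  refine Finset.sum_pos' (fun w _ => ?_) ⟨v, Finset.mem_univ v, ?_⟩
  · split_ifs
    · exact (hf w).le
    · exact le_rfl
  · simpa using hf v

theorem sum_marg_update (f : (V → A) → ℝ) {S : Set V} {i : V} (hi : i ∉ S) (v : V → A) :
    ∑ c : A, marg f ({i} ∪ S) (Function.update v i c) = marg f S v := by
  unfold marg
  rw [Finset.sum_comm]
  refine Finset.sum_congr rfl fun w _ => ?_
  have key : ∀ c : A, (∀ j ∈ {i} ∪ S, w j = Function.update v i c j) ↔
      (w i = c ∧ ∀ j ∈ S, w j = v j) := by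
    intro c
    have hS : ∀ j ∈ S, Function.update v i c j = v j := fun j hj =>
      Function.update_of_ne (ne_of_mem_of_not_mem hj hi) _ _
    constructor
    · intro h
      exact ⟨by simpa using h i (Or.inl rfl), fun j hj => by rw [h j (Or.inr hj), hS j hj]⟩
    · rintro ⟨h1, h2⟩ j (hj | hj)
      · obtain rfl : j = i := hj
        simpa using h1
      · rw [h2 j hj, hS j hj]
  simp only [key]
  by_cases h : ∀ j ∈ S, w j = v j
  · rw [Finset.sum_eq_single (w i) (fun c _ hc => if_neg fun h' => hc h'.1.symm) (by simp),
      if_pos ⟨rfl, h⟩, if_pos h]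
  · rw [if_neg h]
    exact Finset.sum_eq_zero fun c _ => if_neg fun h' => h h'.2

theorem sum_condP_update {f : (V → A) → ℝ} (hf : ∀ v, 0 < f v) {S : Set V} {i : V}
    (hi : i ∉ S) (v : V → A) :
    ∑ c : A, condP f {i} S (Function.update v i c) = 1 := by
  unfold condP
  have h : ∀ c : A, marg f S (Function.update v i c) = marg f S v := fun c =>
    marg_congr f fun j hj => Function.update_of_ne (ne_of_mem_of_not_mem hj hi) _ _
  simp only [h]
  rw [← Finset.sum_div, sum_marg_update f hi, div_self (marg_pos hf S v).ne']

/-- Summation over all assignments, with coordinate `i` summed separately. -/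
theorem sum_eq_sum_sum_update (g : (V → A) → ℝ) (i : V) (b : A) :
    ∑ w, g w = ∑ w, if w i = b then ∑ c : A, g (Function.update w i c) else 0 := by
  have h1 : ∑ w, g w = ∑ c : A, ∑ w, if w i = c then g w else 0 := by
    rw [Finset.sum_comm]
    simp
  have h2 : ∀ w : V → A, (if w i = b then ∑ c : A, g (Function.update w i c) else 0) =
      ∑ c : A, if w i = b then g (Function.update w i c) else 0 := by
    intro w
    split_ifs <;> simp
  simp only [h2]
  rw [h1, Finset.sum_comm (s := (Finset.univ : Finset (V → A)))]
  refine Finset.sum_congr rfl fun c _ => ?_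
  have hφ : Function.Involutive
      fun w : V → A => Function.update w i (Equiv.swap b c (w i)) := by
    intro w
    simp
  rw [← Equiv.sum_comp hφ.toPerm]
  refine Finset.sum_congr rfl fun w _ => ?_
  simp only [Function.Involutive.coe_toPerm, Function.update_self]
  by_cases h : w i = b
  · simp [h]
  · have : Equiv.swap b c (w i) ≠ c := by
      intro h'
      apply h
      have := congrArg (Equiv.swap b c) h'
      simpa using this
    simp [h, this]

theorem sum_mul_eq_of_update {H k : (V → A) → ℝ} {i : V} (b : A)
    (hH : ∀ w c, H (Function.update w i c) = H w)
    (hk : ∀ w, ∑ c : A, k (Function.update w i c) = 1) :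
    ∑ w, H w * k w = ∑ w, if w i = b then H w else 0 := by
  rw [sum_eq_sum_sum_update _ i b]
  refine Finset.sum_congr rfl fun w _ => ?_
  simp only [hH, ← Finset.mul_sum, hk, mul_one]

theorem notMem_parents_self (D : DAG V) (i : V) : i ∉ D.parents i := fun h =>
  D.acyclic i (Relation.TransGen.single h)

/-- Intervening additionally on a node all of whose children are already intervened on
does not affect the interventional distribution of the other nodes. -/
theorem marg_doPMF_insert (D : DAG V) {f : (V → A) → ℝ} (hf : ∀ v, 0 < f v)
    {X Y : Set V} {i : V} (hiX : i ∉ X) (hiY : i ∉ Y) (hch : ∀ j, D.Edge i j → j ∈ X)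
    (a : V → A) :
    marg (D.doPMF f X a) Y a = marg (D.doPMF f (insert i X) a) Y a := by
  let k : (V → A) → ℝ := fun w => condP f {i} (D.parents i) w
  let H : (V → A) → ℝ := fun w =>
    if ∀ j ∈ Y ∪ X, w j = a j then
      ∏ j : V, if j ∈ insert i X then 1 else condP f {j} (D.parents j) w
    else 0
  have hH : ∀ w c, H (Function.update w i c) = H w := by
    intro w c
    have hcond : (∀ j ∈ Y ∪ X, Function.update w i c j = a j) ↔ ∀ j ∈ Y ∪ X, w j = a j := by
      refine forall₂_congr fun j hj => ?_
      rw [Function.update_of_ne]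
      rintro rfl
      exact hj.elim hiY hiX
    have hprod : ∀ j, (if j ∈ insert i X then (1 : ℝ) else
        condP f {j} (D.parents j) (Function.update w i c)) =
        if j ∈ insert i X then 1 else condP f {j} (D.parents j) w := by
      intro j
      split_ifs with hj
      · rfl
      · refine condP_congr f fun l hl => Function.update_of_ne ?_ _ _
        rintro rfl
        rcases hl with hl | hl
        · exact hj (Or.inl hl.symm)
        · exact hj (Or.inr (hch j hl))
    simp only [H, hcond, hprod]
  have hk : ∀ w, ∑ c : A, k (Function.update w i c) = 1 := fun w =>
    sum_condP_update hf (D.notMem_parents_self i) w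
  have hL : marg (D.doPMF f X a) Y a = ∑ w, H w * k w := by
    unfold marg doPMF
    refine Finset.sum_congr rfl fun w _ => ?_
    have hprod : (∏ j : V, if j ∈ X then 1 else condP f {j} (D.parents j) w) =
        (∏ j : V, if j ∈ insert i X then 1 else condP f {j} (D.parents j) w) * k w := by
      rw [← Finset.mul_prod_erase _ _ (Finset.mem_univ i),
        ← Finset.mul_prod_erase (a := i) _
          (fun j => if j ∈ insert i X then 1 else condP f {j} (D.parents j) w)
          (Finset.mem_univ i)]
      rw [if_neg hiX, if_pos (Set.mem_insert i X), one_mul, mul_comm]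
      congr 1
      refine Finset.prod_congr rfl fun j hj => ?_
      have : j ∈ insert i X ↔ j ∈ X := by simp [Finset.ne_of_mem_erase hj]
      simp only [this]
    by_cases h1 : ∀ j ∈ Y, w j = a j
    · by_cases h2 : ∀ j ∈ X, w j = a j
      · have h3 : ∀ j ∈ Y ∪ X, w j = a j := fun j hj => hj.elim (h1 j) (h2 j)
        simp only [H]
        rw [if_pos h1, if_pos h2, if_pos h3, hprod]
      · have h3 : ¬ ∀ j ∈ Y ∪ X, w j = a j := fun h => h2 fun j hj => h j (Or.inr hj)
        simp only [H]
        rw [if_pos h1, if_neg h2, if_neg h3, zero_mul]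
    · have h3 : ¬ ∀ j ∈ Y ∪ X, w j = a j := fun h => h1 fun j hj => h j (Or.inl hj)
      simp only [H]
      rw [if_neg h1, if_neg h3, zero_mul]
  rw [hL, sum_mul_eq_of_update (a i) hH hk]
  unfold marg doPMF
  refine Finset.sum_congr rfl fun w _ => ?_
  simp only [H, Set.mem_union, Set.forall_mem_insert, or_imp, forall_and]
  split_ifs <;> first | tauto | congr!

/-- Enlarging the intervened set from `X` to `T` does not affect the nodes outside `T`
when no edge leaves `T` from a newly added node. -/
theorem marg_doPMF_eq_of_subset (D : DAG V) {f : (V → A) → ℝ} (hf : ∀ v, 0 < f v)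
    {Y T : Set V} (hTY : Disjoint T Y) (a : V → A) {X : Set V} (hXT : X ⊆ T)
    (hT : ∀ i ∈ T \ X, ∀ j, D.Edge i j → j ∈ T) :
    marg (D.doPMF f X a) Y a = marg (D.doPMF f T a) Y a := by
  induction hn : (T \ X).ncard using Nat.strong_induction_on generalizing X with
  | _ n ih =>
    rcases (T \ X).eq_empty_or_nonempty with hemp | hne
    · rw [hXT.antisymm (Set.sdiff_eq_empty.1 hemp)]
    · have : Std.Irrefl (Function.swap (Relation.TransGen D.Edge)) := ⟨D.acyclic⟩
      have : IsTrans V (Function.swap (Relation.TransGen D.Edge)) :=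
        ⟨fun _ _ _ h1 h2 => h2.trans h1⟩
      have hwf : WellFounded (Function.swap (Relation.TransGen D.Edge)) :=
        Finite.wellFounded_of_trans_of_irrefl _
      obtain ⟨i, hi, hmin⟩ := hwf.has_min _ hne
      have hch : ∀ j, D.Edge i j → j ∈ X := fun j hij => by
        by_contra hj
        exact hmin j ⟨hT i hi j hij, hj⟩ (Relation.TransGen.single hij)
      rw [D.marg_doPMF_insert hf hi.2 (Set.disjoint_left.1 hTY hi.1) hch a]
      have hss : T \ insert i X ⊂ T \ X :=
        ⟨Set.sdiff_subset_sdiff_right (Set.subset_insert i X),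
          fun h => (h hi).2 (Set.mem_insert i X)⟩
      exact ih _ (hn ▸ Set.ncard_lt_ncard hss (Set.toFinite _))
        (Set.insert_subset hi.1 hXT) (fun j hj => hT j (hss.1 hj)) rfl

theorem marg_doPMF_empty (D : DAG V) {f : (V → A) → ℝ} (hf : D.IsConsistent f)
    (Y : Set V) (a : V → A) : marg (D.doPMF f ∅ a) Y a = marg f Y a := by
  congr 1
  funext v
  simp [doPMF, ← hf.2.2 v]

end PMF

theorem IsCausal.nodup {D : DAG V} {p : List V} (h : D.IsCausal p) : p.Nodup := by
  have h1 : p.IsChain (Relation.TransGen D.Edge) :=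
    List.IsChain.imp (fun _ _ => Relation.TransGen.single) h
  refine (List.isChain_iff_pairwise.1 h1).imp ?_
  rintro x _ hx rfl
  exact D.acyclic x hx

theorem IsCausal.isPathFrom {D : DAG V} {p : List V} {x y : V} (h : D.IsCausal p)
    (hx : p.head? = some x) (hy : p.getLast? = some y) : D.IsPathFrom p x y :=
  ⟨h.nodup, List.IsChain.imp (fun _ _ => Or.inl) h, hx, hy⟩

/-- The nodes outside `X` having a directed path to `Y` that avoids `X`. -/
def AncAvoiding (D : DAG V) (X Y : Set V) : Set V :=
  {v | ∃ p : List V, p.head? = some v ∧ (∃ y ∈ Y, p.getLast? = some y) ∧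
    D.IsCausal p ∧ ∀ u ∈ p, u ∉ X}

theorem AncAvoiding.notMem {D : DAG V} {X Y : Set V} {v : V}
    (h : v ∈ D.AncAvoiding X Y) : v ∉ X := by
  obtain ⟨p, hp, -, -, hX⟩ := h
  exact hX v (List.mem_of_head? hp)

theorem subset_ancAvoiding (D : DAG V) {X Y : Set V} (h : Disjoint X Y) :
    Y ⊆ D.AncAvoiding X Y := fun y hy =>
  ⟨[y], rfl, ⟨y, hy, rfl⟩, List.isChain_singleton y, by
    simpa using Set.disjoint_right.1 h hy⟩

theorem exists_causal_of_edge {D : DAG V} {X Y : Set V} {u v : V} (huv : D.Edge u v)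
    (hv : v ∈ D.AncAvoiding X Y) :
    ∃ q : List V, ∃ y ∈ Y, D.IsPathFrom (u :: q) u y ∧ D.IsCausal (u :: q) ∧
      ∀ w ∈ q, w ∉ X := by
  obtain ⟨p, hp, ⟨y, hy, hpy⟩, hc, hX⟩ := hv
  obtain ⟨t, rfl⟩ : ∃ t, p = v :: t := by
    cases p with
    | nil => simp at hp
    | cons b t => exact ⟨t, by simp_all⟩
  have hc' : D.IsCausal (u :: v :: t) := List.IsChain.cons_cons huv hc
  exact ⟨v :: t, y, hy, hc'.isPathFrom rfl (by simpa using hpy), hc', hX⟩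

theorem mem_ancAvoiding_of_edge {D : DAG V} {X Y : Set V} {u v : V} (huv : D.Edge u v)
    (hu : u ∉ X) (hv : v ∈ D.AncAvoiding X Y) : u ∈ D.AncAvoiding X Y := by
  obtain ⟨q, y, hy, hp, hc, hX⟩ := exists_causal_of_edge huv hv
  exact ⟨u :: q, rfl, ⟨y, hy, hp.2.2.2⟩, hc, by simpa using ⟨hu, hX⟩⟩

theorem _root_.List.exists_eq_append_cons_of_last_mem {α : Type*} {S : Set α} {p : List α}
    (h : ∃ v ∈ p, v ∈ S) : ∃ l u t, p = l ++ u :: t ∧ u ∈ S ∧ ∀ v ∈ t, v ∉ S := by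
  induction p with
  | nil => simp at h
  | cons b p ih =>
    by_cases hp : ∃ v ∈ p, v ∈ S
    · obtain ⟨l, u, t, rfl, hu, ht⟩ := ih hp
      exact ⟨b :: l, u, t, rfl, hu, ht⟩
    · push Not at hp
      obtain ⟨v, hv, hvS⟩ := h
      rcases List.mem_cons.1 hv with rfl | hv
      · exact ⟨[], v, p, rfl, hvS, hp⟩
      · exact absurd hvS (hp v hv)

theorem IsPathFrom.of_append_cons {D : DAG V} {l t : List V} {x y u : V}
    (h : D.IsPathFrom (l ++ u :: t) x y) : D.IsPathFrom (u :: t) u y := by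
  obtain ⟨h1, h2, -, h4⟩ := h
  refine ⟨(List.nodup_append.1 h1).2.1, ?_, rfl, by simpa using h4⟩
  exact List.IsChain.right_of_append h2

theorem _root_.List.Nodup.eq_of_triple_infix {α : Type*} {p : List α} (hp : p.Nodup)
    {a b c d w : α} (h1 : [a, w, b] <:+: p) (h2 : [c, w, d] <:+: p) : a = c ∧ b = d := by
  obtain ⟨s, t, rfl⟩ := h1
  obtain ⟨s', t', h⟩ := h2
  have hw : w ∉ s ++ [a] ∧ w ∉ b :: t := by
    constructor <;> intro hw <;> simp [List.nodup_append] at hp hw <;> grind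
  have h' : (s' ++ [c]) ++ w :: (d :: t') = (s ++ [a]) ++ w :: (b :: t) := by simpa using h
  obtain ⟨h3, -, h4⟩ := (List.append_cons_inj_of_notMem hw.1 hw.2).1 h'.symm
  exact ⟨by simpa using congrArg List.getLast? h3, (List.cons.inj h4).1⟩

theorem Blocks.of_suffix {D : DAG V} {Z : Set V} {p q : List V} (hp : p.Nodup)
    (hqp : q <:+ p) (h : D.Blocks Z q) : D.Blocks Z p := by
  rcases h with ⟨w, ⟨⟨a, b, hab⟩, hnc⟩, hZ⟩ | ⟨w, ⟨a, b, hab, h⟩, hZ⟩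
  · refine Or.inl ⟨w, ⟨⟨a, b, hab.trans hqp.isInfix⟩, ?_⟩, hZ⟩
    rintro ⟨c, d, hcd, hc, hd⟩
    obtain ⟨rfl, rfl⟩ := hp.eq_of_triple_infix (hab.trans hqp.isInfix) hcd
    exact hnc ⟨a, b, hab, hc, hd⟩
  · exact Or.inr ⟨w, ⟨a, b, hab.trans hqp.isInfix, h⟩, hZ⟩

/-- A path that is proper relative to `X'` either is proper relative to `X ⊇ X'`, or has a
terminal segment starting in `X \ X'` and avoiding `X` afterwards. -/
theorem IsPathFrom.proper_or_suffix {D : DAG V} {X X' : Set V} (hsub : X' ⊆ X)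
    {p : List V} {x y : V} (hp : D.IsPathFrom p x y) (hx : x ∈ X')
    (hprop : ∀ v ∈ p.tail, v ∉ X') :
    (∀ v ∈ p.tail, v ∉ X) ∨ ∃ u t, u ∈ X \ X' ∧ (u :: t) <:+ p ∧
      D.IsPathFrom (u :: t) u y ∧ ∀ v ∈ t, v ∉ X := by
  obtain ⟨l, u, t, rfl, hu, ht⟩ := List.exists_eq_append_cons_of_last_mem (S := X)
    ⟨x, List.mem_of_head? hp.2.2.1, hsub hx⟩
  cases l with
  | nil => exact Or.inl ht
  | cons b l =>
    exact Or.inr ⟨u, t, ⟨hu, hprop u (by simp)⟩, List.suffix_append _ _,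
      hp.of_append_cons, ht⟩

end DAG

open DAG in
/-- Let `X' ⊆ X` be such that there is no causal path from `X \ X'` to
`Y` containing no node of `X` other than its first node.  Then (1) for every strictly
positive pmf consistent with `D` and every assignment: `f(y | do(x)) = f(y)` if
`X' = ∅` and `f(y | do(x)) = f(y | do(x'))` otherwise; and (2) if `X' ≠ ∅` and `Z`
(disjoint from `X ∪ Y`) satisfies the adjustment criterion relative to `(X, Y)` in `D`,
then `Z` satisfies it relative to `(X', Y)` in `D`. -/
theorem preprocessing_exposures
    {V : Type} [Fintype V] [DecidableEq V] {A : Type} [Fintype A] [DecidableEq A]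
    (hcard : 2 ≤ Fintype.card A)
    (D : DAG V) (X Y X' : Set V)
    (hXY : Disjoint X Y) (hX : X.Nonempty) (hY : Y.Nonempty)
    (hsub : X' ⊆ X)
    (hnopath : ¬ ∃ p x y, x ∈ X \ X' ∧ y ∈ Y ∧ D.IsPathFrom p x y ∧
      D.IsCausal p ∧ ∀ v ∈ p.tail, v ∉ X) :
    (∀ f : (V → A) → ℝ, D.IsConsistent f → ∀ a : V → A,
        (X' = ∅ → marg (D.doPMF f X a) Y a = marg f Y a) ∧
        (X' ≠ ∅ → marg (D.doPMF f X a) Y a = marg (D.doPMF f X' a) Y a)) ∧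
    (X' ≠ ∅ → ∀ Z, Disjoint Z (X ∪ Y) → D.SatisfiesAC X Y Z →
        D.SatisfiesAC X' Y Z) := by
  constructor
  · intro f hf a
    have key : marg (D.doPMF f X a) Y a = marg (D.doPMF f X' a) Y a := by
      have hdisj : Disjoint (D.AncAvoiding X Y)ᶜ Y :=
        Set.disjoint_compl_left_iff_subset.2 (D.subset_ancAvoiding hXY)
      have hXT : X ⊆ (D.AncAvoiding X Y)ᶜ := fun v hv h => AncAvoiding.notMem h hv
      have hT : ∀ i ∈ (D.AncAvoiding X Y)ᶜ \ X', ∀ j, D.Edge i j →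
          j ∈ (D.AncAvoiding X Y)ᶜ := by
        intro i hi j hij hj
        by_cases hiX : i ∈ X
        · obtain ⟨q, y, hy, hp, hc, hq⟩ := exists_causal_of_edge hij hj
          exact hnopath ⟨i :: q, i, y, ⟨hiX, hi.2⟩, hy, hp, hc, hq⟩
        · exact hi.1 (mem_ancAvoiding_of_edge hij hiX hj)
      rw [D.marg_doPMF_eq_of_subset hf.1 hdisj a hXT
          fun i hi => hT i ⟨hi.1, fun h => hi.2 (hsub h)⟩,
        D.marg_doPMF_eq_of_subset hf.1 hdisj a (hsub.trans hXT) hT]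
    refine ⟨?_, fun _ => key⟩
    rintro rfl
    rw [key, D.marg_doPMF_empty hf]
  · rintro - Z - ⟨hforb, hblock⟩
    refine ⟨Set.eq_empty_of_forall_notMem ?_, ?_⟩
    · rintro z ⟨hz, p, w, ⟨⟨x, hx, y, hy, hp⟩, hprop, hc⟩, hwp, hwX', hwz⟩
      rcases hp.proper_or_suffix hsub hx hprop with hX | ⟨u, t, hu, hut, hpath, ht⟩
      · refine Set.notMem_empty z
          (hforb ▸ ⟨hz, p, w, ⟨⟨x, hsub hx, y, hy, hp⟩, hX, hc⟩, hwp, ?_, hwz⟩)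
        cases p with
        | nil => simp at hwp
        | cons b t =>
          obtain rfl : b = x := by simpa using hp.2.2.1
          rcases List.mem_cons.1 hwp with rfl | hw
          · exact absurd hx hwX'
          · exact hX w hw
      · exact hnopath ⟨u :: t, u, y, hu, hy, hpath, List.IsChain.suffix hc hut, ht⟩
    · rintro p ⟨⟨x, hx, y, hy, hp⟩, hprop, hnc⟩
      rcases hp.proper_or_suffix hsub hx hprop with hX | ⟨u, t, hu, hut, hpath, ht⟩
      · exact hblock p ⟨⟨x, hsub hx, y, hy, hp⟩, hX, hnc⟩
      · refine Blocks.of_suffix hp.1 hut (hblock _ ⟨⟨u, hu.1, y, hy, hpath⟩, ht, fun hc => ?_⟩)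
        exact hnopath ⟨u :: t, u, y, hu, hy, hpath, hc, ht⟩
end

section
/- Let 𝐗 and 𝐘 be disjoint nonempty node sets in a DAG D, and assume there exists a set Z, disjoint from 𝐗 ∪ 𝐘, satisfying the adjustment criterion relative to (𝐗,𝐘) in D with Z ∩ De(𝐗,D) = ∅. Then there is no back-door set relative to (𝐗,𝐘) in D if and only if there exist X ∈ 𝐗, Y ∈ 𝐘 and a path p from X to Y in D such that: (i) the first edge of p points into X (p is a back-door path); (ii) there is a node X'' ∈ 𝐗 on p with X'' ≠ X such that the subpath of p from X'' to Y is a proper causal path from 𝐗 to 𝐘; (iii) there are no colliders on p; and (iv) all nodes on p are in De(𝐗,D). -/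
attribute [local instance] Classical.propDecidable

namespace DAG

variable {V : Type} [Fintype V] [DecidableEq V]

/-- A node of a list is its first node, its last node, or the middle of three consecutive nodes. -/
theorem head_or_getLast_or_interior {α : Type*} {p : List α} {w : α} (hw : w ∈ p) :
    p.head? = some w ∨ p.getLast? = some w ∨ ∃ a b, [a, w, b] <:+: p := by
  obtain ⟨s, t, rfl⟩ := List.append_of_mem hw
  rcases List.eq_nil_or_concat s with rfl | ⟨s', a, rfl⟩
  · simp
  · rcases t with _ | ⟨b, t⟩
    · simp
    · exact Or.inr (Or.inr ⟨a, b, s', t, by simp⟩)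

/-- In a list of distinct nodes, the successor of a node is unique. -/
theorem eq_right_of_infix {α : Type*} {p : List α} (hp : p.Nodup) {a w b a' b' : α}
    (h : [a, w, b] <:+: p) (h' : [a', w, b'] <:+: p) : b = b' := by
  obtain ⟨s, t, rfl⟩ := h
  obtain ⟨s', t', h'⟩ := h'
  have e : (s' ++ [a']) ++ w :: (b' :: t') = (s ++ [a]) ++ w :: (b :: t) := by simpa using h'
  have hp' : ((s' ++ [a']) ++ w :: (b' :: t')).Nodup := by
    rw [e]
    simpa using hp
  simp only [List.nodup_append, List.nodup_cons, List.mem_cons] at hp'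
  have h₁ : w ∉ s' ++ [a'] := fun hw => hp'.2.2 w hw w (Or.inl rfl) rfl
  have h₂ : w ∉ b' :: t' := by simpa using hp'.2.1.1
  have := (List.append_cons_inj_of_notMem h₁ h₂).1 e
  simp_all

/-- A list meeting `X` has a suffix that starts in `X` and does not meet `X` again. -/
theorem exists_suffix_last_mem {α : Type*} (X : Set α) (p : List α) (h : ∃ v ∈ p, v ∈ X) :
    ∃ v ∈ X, ∃ t, v :: t <:+ p ∧ ∀ w ∈ t, w ∉ X := by
  induction p with
  | nil => simp at h
  | cons u p ih =>
    by_cases hp : ∃ v ∈ p, v ∈ X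
    · obtain ⟨v, hv, t, ht, htX⟩ := ih hp
      exact ⟨v, hv, t, ht.trans (List.suffix_cons u p), htX⟩
    · refine ⟨u, ?_, p, List.suffix_refl _, fun w hw hwX => hp ⟨w, hw, hwX⟩⟩
      obtain ⟨v, hv, hvX⟩ := h
      rcases List.mem_cons.1 hv with rfl | hv
      · exact hvX
      · exact absurd ⟨v, hv, hvX⟩ hp

theorem reflTransGen_of_isChain {α : Type*} {R : α → α → Prop} {t : List α} {v : α}
    (h : List.IsChain R (v :: t)) : ∀ w ∈ v :: t, Relation.ReflTransGen R v w := by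
  induction t generalizing v with
  | nil => intro w hw; simp at hw; subst hw; exact .refl
  | cons u t ih =>
    intro w hw
    rw [List.isChain_cons_cons] at h
    rcases List.mem_cons.1 hw with rfl | hw
    · exact .refl
    · exact .head h.1 (ih h.2 w hw)

theorem edge_asymm (D : DAG V) {a b : V} (h : D.Edge a b) (h' : D.Edge b a) : False :=
  D.acyclic a (.tail (.single h) h')

theorem mem_desc_of_reflTransGen (D : DAG V) {S : Set V} {a b : V} (ha : a ∈ D.Desc S)
    (h : Relation.ReflTransGen D.Edge a b) : b ∈ D.Desc S := by
  obtain ⟨x, hx, hxa⟩ := ha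
  exact ⟨x, hx, hxa.trans h⟩

theorem subset_desc (D : DAG V) (S : Set V) : S ⊆ D.Desc S := fun x hx => ⟨x, hx, .refl⟩

/-- A path of distinct nodes starting in `X` that is not blocked by the set of non-descendants
of `X` has no colliders. -/
theorem no_collider_of_not_blocks_compl_desc (D : DAG V) {X : Set V} {p : List V} {x : V}
    (hx : x ∈ X) (hp : p.Nodup) (hhead : p.head? = some x)
    (hb : ¬ D.Blocks (D.Desc X)ᶜ p) (c : V) : ¬ D.IsColliderOn p c := by
  rintro ⟨a, b, hi, hac, hbc⟩
  have hc : c ∉ D.Desc X := by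
    intro hc
    refine hb (Or.inr ⟨c, ⟨a, b, hi, hac, hbc⟩, ?_⟩)
    ext v
    simp only [Set.mem_inter_iff, Set.mem_compl_iff, Set.mem_empty_iff_false, iff_false, not_and,
      not_not]
    rintro ⟨_, rfl, hv⟩
    exact D.mem_desc_of_reflTransGen hc hv
  have ha : a ∉ D.Desc X := fun ha => hc (D.mem_desc_of_reflTransGen ha (.single hac))
  obtain ⟨s, t, hst⟩ := hi
  rcases List.eq_nil_or_concat s with rfl | ⟨s', a₀, rfl⟩
  · have : a = x := by simpa [← hst] using hhead
    exact ha (this ▸ D.subset_desc X hx)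
  · have hi' : [a₀, a, c] <:+: p := ⟨s', b :: t, by simpa using hst⟩
    refine hb (Or.inl ⟨a, ⟨⟨a₀, c, hi'⟩, ?_⟩, ha⟩)
    rintro ⟨a₁, c', hi'', -, hca⟩
    obtain rfl := eq_right_of_infix hp hi' hi''
    exact D.edge_asymm hac hca

/-- Assume some set `Z` disjoint from `X ∪ Y` with `Z ∩ De(X,D) = ∅`
satisfies the adjustment criterion relative to `(X, Y)` in `D`.  Then there is no
back-door set relative to `(X, Y)` in `D` iff there are `x ∈ X`, `y ∈ Y` and a path `p`
from `x` to `y` such that (i) `p` is a back-door path, (ii) a proper subpath of `p` is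
a proper causal path from `X` to `Y` starting at some `x'' ∈ X` with `x'' ≠ x`,
(iii) there are no colliders on `p`, and (iv) all nodes of `p` are in `De(X,D)`. -/
theorem no_backdoor_set_characterization
    (D : DAG V) (X Y : Set V)
    (hXY : Disjoint X Y) (hX : X.Nonempty) (hY : Y.Nonempty)
    (hexists : ∃ Z, Disjoint Z (X ∪ Y) ∧ D.SatisfiesAC X Y Z ∧ Z ∩ D.Desc X = ∅) :
    (¬ ∃ Z, D.BackdoorCriterion X Y Z) ↔
      ∃ x ∈ X, ∃ y ∈ Y, ∃ p, D.IsPathFrom p x y ∧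
        D.IsBackdoorFrom p x ∧
        (∃ x'' ∈ X, x'' ≠ x ∧ ∃ s, s <:+ p ∧ s.head? = some x'' ∧
          D.ProperCausalPath X Y s) ∧
        (∀ w, ¬ D.IsColliderOn p w) ∧
        (∀ w ∈ p, w ∈ D.Desc X) := by
  constructor
  · intro hno
    obtain ⟨Z₀, -, ⟨-, hZ₀⟩, hdisj⟩ := hexists
    have hnot : ¬ D.BackdoorCriterion X Y (D.Desc X)ᶜ := fun h => hno ⟨_, h⟩
    simp only [BackdoorCriterion, Set.compl_inter_self, true_and, not_forall] at hnot
    obtain ⟨x, hx, y, hy, p, hp, hback, hb⟩ := hnot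
    obtain ⟨hnd, hch, hhead, hlast⟩ := id hp
    have hcol := D.no_collider_of_not_blocks_compl_desc hx hnd hhead hb
    have hint : ∀ a w b, [a, w, b] <:+: p → w ∈ D.Desc X := by
      intro a w b hi
      by_contra hw
      exact hb (Or.inl ⟨w, ⟨⟨a, b, hi⟩, hcol w⟩, hw⟩)
    obtain ⟨v, hv, t, hs, htX⟩ :=
      exists_suffix_last_mem X p ⟨x, List.mem_of_mem_head? hhead, hx⟩
    have hsy : D.IsPathFrom (v :: t) v y := by
      refine ⟨hnd.sublist hs.sublist, hch.suffix hs, rfl, ?_⟩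
      obtain ⟨q, rfl⟩ := hs
      simpa using hlast
    have hcausal : D.IsCausal (v :: t) := by
      by_contra hnc
      rcases hZ₀ _ ⟨⟨v, hv, y, hy, hsy⟩, htX, hnc⟩ with
        ⟨w, ⟨⟨a, b, hi⟩, -⟩, hw⟩ | ⟨w, ⟨a, b, hi, hab⟩, -⟩
      · have : w ∈ Z₀ ∩ D.Desc X := ⟨hw, hint a w b (hi.trans hs.isInfix)⟩
        simp [hdisj] at this
      · exact hcol w ⟨a, b, hi.trans hs.isInfix, hab⟩
    have hvx : v ≠ x := by
      rintro rfl
      obtain ⟨b, rest, rfl, hbx⟩ := hback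
      obtain ⟨q, hq⟩ := hs
      rcases q with _ | ⟨u, q⟩
      · obtain rfl : t = b :: rest := by simpa using hq
        exact D.edge_asymm (List.isChain_cons_cons.1 hcausal).1 hbx
      · simp only [List.cons_append, List.cons.injEq] at hq
        refine (List.nodup_cons.1 hnd).1 ?_
        rw [← hq.2]
        simp
    refine ⟨x, hx, y, hy, p, hp, hback,
      ⟨v, hv, hvx, v :: t, hs, rfl, ⟨v, hv, y, hy, hsy⟩, htX, hcausal⟩, hcol, ?_⟩
    intro w hw
    rcases head_or_getLast_or_interior hw with h | h | ⟨a, b, h⟩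
    · have hxw : x = w := by simpa [hhead] using h
      exact hxw ▸ D.subset_desc X hx
    · obtain rfl : y = w := by simpa [hlast] using h
      exact ⟨v, hv, reflTransGen_of_isChain hcausal y (List.mem_of_getLast? hsy.2.2.2)⟩
    · exact hint a w b h
  · rintro ⟨x, hx, y, hy, p, hp, hback, -, hcol, hdesc⟩ ⟨Z, hZ, hblock⟩
    rcases hblock x hx y hy p hp hback with ⟨w, ⟨⟨a, b, hi⟩, -⟩, hw⟩ | ⟨w, hw, -⟩
    · have : w ∈ Z ∩ D.Desc X := ⟨hw, hdesc w (hi.subset (by simp))⟩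
      simp [hZ] at this
    · exact hcol w hw

end DAG
end
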